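/- Let n₀, n₁, m₀, m₁ be natural numbers. For natural numbers N, M let σ_{N,M} denote the self-map of the one-point compactification of ℂ^N × ℝ^M obtained by extending the map (v, x) ↦ (i·v, −x) (coordinatewise multiplication by the imaginary unit on the ℂ^N factor and negation on the ℝ^M factor) by sending the point at infinity ∞ to ∞. Suppose there exists a continuous map f from the one-point compactification of ℂ^{n₀} × ℝ^{m₀} to the one-point compactification of ℂ^{n₁} × ℝ^{m₁} such that f(∞) = ∞, f(0) = 0, and f ∘ σ_{n₀,m₀} = σ_{n₁,m₁} ∘ f. Then n₀ − n₁ ≤ m₁ − m₀ (as an inequality of integers). -/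

import Mathlib

open OnePoint

/-- The involution-like self-map `σ_{N,M}` of the one-point compactification of
`ℂ^N × ℝ^M`, extending `(v, x) ↦ (i • v, -x)` by `∞ ↦ ∞`. -/
noncomputable def sigmaMap (N M : ℕ) :
    OnePoint (EuclideanSpace ℂ (Fin N) × EuclideanSpace ℝ (Fin M)) →
      OnePoint (EuclideanSpace ℂ (Fin N) × EuclideanSpace ℝ (Fin M)) :=
  OnePoint.map fun p => (Complex.I • p.1, -p.2)

namespace WeakBorsukUlam

open Matrix Module Filter Topology
open scoped Matrix.Norms.L2Operator

set_option linter.unusedSectionVars false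

section Inertia

variable {ι α β : Type*} [Fintype ι] [DecidableEq ι] [Fintype α] [DecidableEq α]
  [Fintype β] [DecidableEq β]

/-- The Euclidean norm of a finite family of complex numbers. -/
noncomputable def eNorm (ξ : ι → ℂ) : ℝ := ‖(WithLp.toLp 2 ξ : EuclideanSpace ℂ ι)‖

lemma eNorm_sq (ξ : ι → ℂ) : eNorm ξ ^ 2 = ∑ a, ‖ξ a‖ ^ 2 := by
  simp [eNorm, EuclideanSpace.norm_sq_eq]

lemma eNorm_nonneg (ξ : ι → ℂ) : 0 ≤ eNorm ξ := norm_nonneg _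

lemma eNorm_pos {ξ : ι → ℂ} (h : ξ ≠ 0) : 0 < eNorm ξ := by
  rw [eNorm, norm_pos_iff]
  simpa using h

lemma eNorm_add_le (ξ η : ι → ℂ) : eNorm (ξ + η) ≤ eNorm ξ + eNorm η := by
  simpa [eNorm] using norm_add_le (WithLp.toLp 2 ξ : EuclideanSpace ℂ ι) (WithLp.toLp 2 η)

lemma eNorm_mulVec_le (A : Matrix α ι ℂ) (ξ : ι → ℂ) : eNorm (A *ᵥ ξ) ≤ ‖A‖ * eNorm ξ :=
  l2_opNorm_mulVec A (WithLp.toLp 2 ξ)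

/-- The real part of the sesquilinear form of a matrix on the diagonal. -/
noncomputable def qForm (M : Matrix ι ι ℂ) (ξ : ι → ℂ) : ℝ := (star ξ ⬝ᵥ M *ᵥ ξ).re

lemma qForm_add (M M' : Matrix ι ι ℂ) (ξ : ι → ℂ) :
    qForm (M + M') ξ = qForm M ξ + qForm M' ξ := by
  simp [qForm, add_mulVec, dotProduct_add]

lemma abs_qForm_le (M : Matrix ι ι ℂ) (ξ : ι → ℂ) : |qForm M ξ| ≤ ‖M‖ * eNorm ξ ^ 2 := by
  have h : star ξ ⬝ᵥ M *ᵥ ξ =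
      inner ℂ (WithLp.toLp 2 ξ : EuclideanSpace ℂ ι) (WithLp.toLp 2 (M *ᵥ ξ)) := by
    rw [EuclideanSpace.inner_toLp_toLp, dotProduct_comm]
  calc |qForm M ξ| ≤ ‖star ξ ⬝ᵥ M *ᵥ ξ‖ := Complex.abs_re_le_norm _
    _ ≤ eNorm ξ * eNorm (M *ᵥ ξ) := by rw [h]; exact norm_inner_le_norm _ _
    _ ≤ eNorm ξ * (‖M‖ * eNorm ξ) := by
        gcongr
        · exact eNorm_nonneg _
        · exact eNorm_mulVec_le _ _
    _ = ‖M‖ * eNorm ξ ^ 2 := by ring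

/-- The positive index of inertia: the largest dimension of a subspace on which the form of `M`
is positive definite. -/
noncomputable def posIdx (M : Matrix ι ι ℂ) : ℕ :=
  sSup {d | ∃ U : Submodule ℂ (ι → ℂ), (∀ ξ ∈ U, ξ ≠ 0 → 0 < qForm M ξ) ∧ finrank ℂ U = d}

lemma posIdx_eq {M : Matrix ι ι ℂ} {P N : Submodule ℂ (ι → ℂ)}
    (hP : ∀ ξ ∈ P, ξ ≠ 0 → 0 < qForm M ξ) (hN : ∀ ξ ∈ N, qForm M ξ ≤ 0)
    (h : finrank ℂ P + finrank ℂ N = Fintype.card ι) : posIdx M = finrank ℂ P := by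
  apply IsGreatest.csSup_eq
  refine ⟨⟨P, hP, rfl⟩, ?_⟩
  rintro d ⟨U, hU, rfl⟩
  have hdis : U ⊓ N = ⊥ := by
    rw [Submodule.eq_bot_iff]
    rintro ξ ⟨h1, h2⟩
    by_contra h0
    exact absurd (hU ξ h1 h0) (not_lt.2 (hN ξ h2))
  have h1 := Submodule.finrank_sup_add_finrank_inf_eq U N
  rw [hdis, finrank_bot] at h1
  have h2 := Submodule.finrank_le (U ⊔ N)
  rw [finrank_fintype_fun_eq_card] at h2
  omega

/-- A matrix is bounded below by `c` if it expands Euclidean norms by a factor at least `c`. -/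
def BoundedBelow (M : Matrix ι ι ℂ) (c : ℝ) : Prop := ∀ ξ, c * eNorm ξ ≤ eNorm (M *ᵥ ξ)

lemma exists_spectral_split {M : Matrix ι ι ℂ} (hM : M.IsHermitian) {c : ℝ}
    (hb : BoundedBelow M c) : ∃ P N : Submodule ℂ (ι → ℂ),
      finrank ℂ P + finrank ℂ N = Fintype.card ι ∧
      (∀ ξ ∈ P, c * eNorm ξ ^ 2 ≤ qForm M ξ) ∧ (∀ ξ ∈ N, qForm M ξ ≤ -c * eNorm ξ ^ 2) := by
  set U : Matrix ι ι ℂ := (hM.eigenvectorUnitary : Matrix ι ι ℂ) with hU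
  set l := hM.eigenvalues with hl
  have hUU : Uᴴ * U = 1 := by
    have := (Matrix.mem_unitaryGroup_iff'.1 hM.eigenvectorUnitary.2)
    simpa [star_eq_conjTranspose] using this
  have hMU : ∀ z, M *ᵥ (U *ᵥ z) = U *ᵥ (fun i => (l i : ℂ) * z i) := by
    intro z
    have h1 : M * U = U * diagonal (fun i => (l i : ℂ)) := by
      have h := hM.spectral_theorem
      rw [Unitary.conjStarAlgAut_apply] at h
      have h2 : (star (hM.eigenvectorUnitary : Matrix ι ι ℂ)) * U = 1 := by
        simpa [star_eq_conjTranspose] using hUU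
      calc M * U = (U * diagonal (RCLike.ofReal ∘ l) *
            star (hM.eigenvectorUnitary : Matrix ι ι ℂ)) * U := by
            exact congrArg (· * U) h
        _ = U * diagonal (RCLike.ofReal ∘ l) := by rw [mul_assoc, h2, mul_one]
        _ = _ := rfl
    rw [mulVec_mulVec, h1, ← mulVec_mulVec]
    congr 1
    ext i
    simp [mulVec_diagonal]
  have hdot : ∀ z w, star (U *ᵥ z) ⬝ᵥ (U *ᵥ w) = star z ⬝ᵥ w := by
    intro z w
    rw [star_mulVec, ← dotProduct_mulVec, mulVec_mulVec, hUU, one_mulVec]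
  have hn : ∀ z, eNorm (U *ᵥ z) ^ 2 = ∑ i, ‖z i‖ ^ 2 := by
    intro z
    have key : ∀ y : ι → ℂ, (eNorm y ^ 2 : ℝ) = (star y ⬝ᵥ y).re := by
      intro y
      rw [eNorm_sq]
      simp only [dotProduct, Complex.re_sum, Pi.star_apply]
      refine Finset.sum_congr rfl fun i _ => ?_
      rw [← Complex.normSq_eq_norm_sq]
      simp [Complex.normSq_apply]
    rw [key, hdot, ← key, eNorm_sq]
  have hq : ∀ z, qForm M (U *ᵥ z) = ∑ i, l i * ‖z i‖ ^ 2 := by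
    intro z
    rw [qForm, hMU, hdot]
    simp only [dotProduct, Complex.re_sum, Pi.star_apply]
    refine Finset.sum_congr rfl fun i _ => ?_
    rw [← Complex.normSq_eq_norm_sq]
    simp [Complex.normSq_apply]
    ring
  have hlc : ∀ i, c ≤ |l i| := by
    intro i
    have h1 := hb (U *ᵥ Pi.single i 1)
    have e1 : eNorm (U *ᵥ Pi.single i 1) = 1 := by
      have := hn (Pi.single i 1)
      rw [Finset.sum_eq_single i] at this
      · simp only [Pi.single_eq_same, norm_one, one_pow] at this
        nlinarith [eNorm_nonneg (U *ᵥ Pi.single i 1)]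
      · intro b _ hbi; simp [hbi]
      · simp
    have e2 : eNorm (M *ᵥ (U *ᵥ Pi.single i 1)) = |l i| := by
      rw [hMU]
      have := hn (fun j => (l j : ℂ) * (Pi.single i 1 : ι → ℂ) j)
      rw [Finset.sum_eq_single i] at this
      · simp only [Pi.single_eq_same, mul_one, Complex.norm_real, Real.norm_eq_abs] at this
        exact (sq_eq_sq₀ (eNorm_nonneg _) (abs_nonneg _)).1 this
      · intro b _ hbi; simp [hbi]
      · simp
    rw [e1, e2] at h1
    linarith
  have hUinj : Function.Injective U.mulVecLin := by
    intro x y hxy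
    have h1 : Uᴴ *ᵥ (U *ᵥ x) = Uᴴ *ᵥ (U *ᵥ y) := by
      have : U *ᵥ x = U *ᵥ y := hxy
      rw [this]
    simpa [mulVec_mulVec, hUU] using h1
  have hext : ∀ p : ι → Prop, ∀ z : {i // p i} → ℂ, ∀ i, ¬ p i →
      Function.ExtendByZero.linearMap ℂ (Subtype.val : {i // p i} → ι) z i = 0 := by
    intro p z i hi
    simp only [Function.ExtendByZero.linearMap_apply]
    rw [Function.extend_apply' _ _ _ (by rintro ⟨a, rfl⟩; exact hi a.2)]
    rfl
  have hrank : ∀ p : ι → Prop, finrank ℂ (LinearMap.range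
      (U.mulVecLin ∘ₗ Function.ExtendByZero.linearMap ℂ (Subtype.val : {i // p i} → ι))) =
      Nat.card {i // p i} := by
    intro p
    classical
    rw [LinearMap.finrank_range_of_inj, finrank_fintype_fun_eq_card, Nat.card_eq_fintype_card]
    rw [LinearMap.coe_comp]
    refine hUinj.comp ?_
    intro x y hxy
    ext i
    have := congrFun hxy i.1
    simpa [Function.ExtendByZero.linearMap_apply, Subtype.val_injective.extend_apply] using this
  refine ⟨LinearMap.range (U.mulVecLin ∘ₗ
      Function.ExtendByZero.linearMap ℂ (Subtype.val : {i // 0 < l i} → ι)),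
    LinearMap.range (U.mulVecLin ∘ₗ
      Function.ExtendByZero.linearMap ℂ (Subtype.val : {i // ¬ 0 < l i} → ι)), ?_, ?_, ?_⟩
  · rw [hrank, hrank]
    classical
    rw [Nat.card_eq_fintype_card, Nat.card_eq_fintype_card, Fintype.card_subtype_compl]
    have := Fintype.card_subtype_le (fun i => 0 < l i)
    omega
  · rintro _ ⟨z, rfl⟩
    simp only [LinearMap.comp_apply, mulVecLin_apply]
    rw [hn, hq, Finset.mul_sum]
    refine Finset.sum_le_sum fun i _ => ?_
    by_cases hi : 0 < l i
    · have := hlc i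
      rw [abs_of_pos hi] at this
      gcongr
    · rw [hext _ z i hi]; simp
  · rintro _ ⟨z, rfl⟩
    simp only [LinearMap.comp_apply, mulVecLin_apply]
    rw [hn, hq, Finset.mul_sum]
    refine Finset.sum_le_sum fun i _ => ?_
    by_cases hi : 0 < l i
    · rw [hext (fun i => ¬ 0 < l i) z i (not_not.2 hi)]; simp
    · have := hlc i
      rw [abs_of_nonpos (not_lt.1 hi)] at this
      gcongr
      linarith

lemma posIdx_eq_of_close {M M' : Matrix ι ι ℂ} (hM : M.IsHermitian) {c : ℝ}
    (hb : BoundedBelow M c) (h : ∀ ξ, ξ ≠ 0 → |qForm M' ξ - qForm M ξ| < c * eNorm ξ ^ 2) :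
    posIdx M' = posIdx M := by
  obtain ⟨P, N, hPN, hP, hN⟩ := exists_spectral_split hM hb
  have key : ∀ K : Matrix ι ι ℂ, (∀ ξ, ξ ≠ 0 → |qForm K ξ - qForm M ξ| < c * eNorm ξ ^ 2) →
      posIdx K = finrank ℂ P := by
    intro K hK
    refine posIdx_eq (N := N) ?_ ?_ hPN
    · intro ξ hξ h0
      have := abs_lt.1 (hK ξ h0)
      linarith [hP ξ hξ]
    · intro ξ hξ
      by_cases h0 : ξ = 0
      · simp [h0, qForm]
      · have := abs_lt.1 (hK ξ h0)
        linarith [hN ξ hξ]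
  rw [key M' h, key M]
  intro ξ h0
  have := (abs_nonneg _).trans_lt (h ξ h0)
  simpa using this

lemma qForm_pos_of_le {P : Submodule ℂ (ι → ℂ)} {K : Matrix ι ι ℂ} {c : ℝ} (hc : 0 < c)
    (hK : ∀ ξ ∈ P, c * eNorm ξ ^ 2 ≤ qForm K ξ) : ∀ ξ ∈ P, ξ ≠ 0 → 0 < qForm K ξ :=
  fun ξ hξ hne => lt_of_lt_of_le (mul_pos hc (pow_pos (eNorm_pos hne) 2)) (hK ξ hξ)

lemma qForm_nonpos_of_le {P : Submodule ℂ (ι → ℂ)} {K : Matrix ι ι ℂ} {c : ℝ} (hc : 0 < c)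
    (hK : ∀ ξ ∈ P, qForm K ξ ≤ -c * eNorm ξ ^ 2) : ∀ ξ ∈ P, qForm K ξ ≤ 0 := by
  intro ξ hξ
  have := mul_nonneg hc.le (sq_nonneg (eNorm ξ))
  linarith [hK ξ hξ]

lemma posIdx_sum (e : α ⊕ β ≃ ι) {M : Matrix ι ι ℂ} (hM : M.IsHermitian)
    (h0 : ∀ a b, M (e (.inl a)) (e (.inr b)) = 0) {c : ℝ} (hc : 0 < c) (hb : BoundedBelow M c) :
    posIdx M = posIdx (M.submatrix (e ∘ .inl) (e ∘ .inl)) +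
      posIdx (M.submatrix (e ∘ .inr) (e ∘ .inr)) := by
  set A := M.submatrix (e ∘ Sum.inl) (e ∘ Sum.inl) with hA
  set B := M.submatrix (e ∘ Sum.inr) (e ∘ Sum.inr) with hB
  have h0' : ∀ a b, M (e (.inr b)) (e (.inl a)) = 0 := by
    intro a b
    rw [← hM.apply, h0, star_zero]
  let E : ((α → ℂ) × (β → ℂ)) ≃ₗ[ℂ] (ι → ℂ) :=
    (LinearEquiv.sumArrowLequivProdArrow α β ℂ ℂ).symm ≪≫ₗ LinearEquiv.funCongrLeft ℂ ℂ e.symm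
  have hE : ∀ p s, E p (e s) = Sum.elim p.1 p.2 s := by
    intro p s
    simp only [E, LinearEquiv.trans_apply, LinearEquiv.funCongrLeft_apply, LinearMap.funLeft_apply,
      Equiv.symm_apply_apply]
    cases s <;> rfl
  have hmul : ∀ p, M *ᵥ (E p) = E (A *ᵥ p.1, B *ᵥ p.2) := by
    intro p
    ext i
    obtain ⟨s, rfl⟩ := e.surjective i
    rw [hE, mulVec, dotProduct, ← e.sum_comp, Fintype.sum_sum_type]
    cases s <;> simp [hE, h0, h0', mulVec, dotProduct, A, B]
  have hnorm : ∀ p, eNorm (E p) ^ 2 = eNorm p.1 ^ 2 + eNorm p.2 ^ 2 := by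
    intro p
    simp only [eNorm_sq]
    rw [← e.sum_comp, Fintype.sum_sum_type]
    simp [hE]
  have hq : ∀ p, qForm M (E p) = qForm A p.1 + qForm B p.2 := by
    intro p
    simp only [qForm, hmul, ← Complex.add_re]
    congr 1
    simp only [dotProduct]
    rw [← e.sum_comp, Fintype.sum_sum_type]
    simp [hE]
  have hbA : BoundedBelow A c := by
    intro ξ
    have h1 := hb (E (ξ, 0))
    have h2 := hnorm (ξ, 0)
    have h3 := hnorm (A *ᵥ ξ, 0)
    rw [hmul] at h1
    have hz : eNorm (0 : β → ℂ) = 0 := by simp [eNorm]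
    simp only [hz, mulVec_zero] at h1 h2 h3
    rw [zero_pow two_ne_zero, add_zero, sq_eq_sq₀ (eNorm_nonneg _) (eNorm_nonneg _)] at h2 h3
    rwa [h2, h3] at h1
  have hbB : BoundedBelow B c := by
    intro ξ
    have h1 := hb (E (0, ξ))
    have h2 := hnorm (0, ξ)
    have h3 := hnorm (0, B *ᵥ ξ)
    rw [hmul] at h1
    have hz : eNorm (0 : α → ℂ) = 0 := by simp [eNorm]
    simp only [hz, mulVec_zero] at h1 h2 h3
    rw [zero_pow two_ne_zero, zero_add, sq_eq_sq₀ (eNorm_nonneg _) (eNorm_nonneg _)] at h2 h3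
    rwa [h2, h3] at h1
  obtain ⟨P₁, N₁, e₁, hP₁, hN₁⟩ := exists_spectral_split (hM.submatrix _) hbA
  obtain ⟨P₂, N₂, e₂, hP₂, hN₂⟩ := exists_spectral_split (hM.submatrix _) hbB
  have hprod : ∀ (U : Submodule ℂ (α → ℂ)) (V : Submodule ℂ (β → ℂ)),
      finrank ℂ ((U.prod V).map (E : ((α → ℂ) × (β → ℂ)) →ₗ[ℂ] (ι → ℂ))) =
        finrank ℂ U + finrank ℂ V := by
    intro U V
    have h1 : U.prod V = LinearMap.range (U.subtype.prodMap V.subtype) := by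
      rw [LinearMap.range_prodMap]; simp
    rw [LinearEquiv.finrank_map_eq E, h1, LinearMap.finrank_range_of_inj, finrank_prod]
    exact Function.Injective.prodMap U.subtype_injective V.subtype_injective
  rw [posIdx_eq (qForm_pos_of_le hc hP₁) (qForm_nonpos_of_le hc hN₁) e₁,
    posIdx_eq (qForm_pos_of_le hc hP₂) (qForm_nonpos_of_le hc hN₂) e₂, ← hprod]
  refine posIdx_eq (N := (N₁.prod N₂).map (E : ((α → ℂ) × (β → ℂ)) →ₗ[ℂ] (ι → ℂ))) ?_ ?_ ?_
  · rintro _ ⟨p, hp, rfl⟩ hne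
    have hp0 : p ≠ 0 := by rintro rfl; simp at hne
    have h1 := hP₁ p.1 hp.1
    have h2 := hP₂ p.2 hp.2
    have h3 := hnorm p
    have h4 := hq p
    have h5 : 0 < eNorm (E p) := eNorm_pos hne
    have := mul_pos hc (pow_pos h5 2)
    simp only [LinearEquiv.coe_coe]
    rw [h4]
    rw [h3] at this
    linarith
  · rintro _ ⟨p, hp, rfl⟩
    simp only [LinearEquiv.coe_coe]
    rw [hq]
    linarith [qForm_nonpos_of_le hc hN₁ _ hp.1, qForm_nonpos_of_le hc hN₂ _ hp.2]
  · rw [hprod, hprod]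
    have := Fintype.card_congr e
    rw [Fintype.card_sum] at this
    omega

end Inertia

section GradedIndex

variable {ι α β : Type*} [Fintype ι] [DecidableEq ι] [Fintype α] [DecidableEq α]
  [Fintype β] [DecidableEq β]

/-- The character `c ↦ i ^ c` of `ℤ/4` with values in the Gaussian integers. -/
def i4 : AddChar (ZMod 4) GaussianInt :=
  AddChar.zmodChar 4 (ζ := (⟨0, 1⟩ : GaussianInt)) (by decide)

/-- The character `c ↦ i ^ c` of `ℤ/4` with values in the complex numbers. -/
noncomputable def χ (c : ZMod 4) : ℂ := GaussianInt.toComplex (i4 c)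

lemma χ_add (c d : ZMod 4) : χ (c + d) = χ c * χ d := by
  simp [χ, AddChar.map_add_eq_mul]

lemma χ_zero : χ 0 = 1 := by simp [χ]

lemma χ_one : χ 1 = Complex.I := by
  have : i4 1 = ⟨0, 1⟩ := by decide
  simp [χ, this, GaussianInt.toComplex_def]

lemma χ_two : χ 2 = -1 := by
  rw [show (2 : ZMod 4) = 1 + 1 from rfl, χ_add, χ_one, Complex.I_mul_I]

lemma χ_pow_four (c : ZMod 4) : χ c ^ 4 = 1 := by
  have : i4 c ^ 4 = 1 := by revert c; decide
  simp [χ, ← map_pow, this]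

lemma norm_χ (c : ZMod 4) : ‖χ c‖ = 1 :=
  Complex.norm_eq_one_of_pow_eq_one (χ_pow_four c) (by norm_num)

lemma χ_neg_mul (c : ZMod 4) : χ (-c) * χ c = 1 := by
  rw [← χ_add, neg_add_cancel, χ_zero]

lemma star_χ (c : ZMod 4) : star (χ c) = χ (-c) := by
  have h : star (χ c) * χ c = 1 := by
    rw [mul_comm]
    have := Complex.mul_conj (χ c)
    rw [Complex.normSq_eq_norm_sq, norm_χ] at this
    simpa using this
  calc star (χ c) = star (χ c) * (χ (-c) * χ c) := by rw [χ_neg_mul, mul_one]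
    _ = χ (-c) * (star (χ c) * χ c) := by ring
    _ = χ (-c) := by rw [h, mul_one]

lemma eq_zero_of_χ_eq_one {c : ZMod 4} (h : χ c = 1) : c = 0 := by
  have h1 : i4 c = 1 := by
    apply GaussianInt.toComplex_injective
    rw [map_one]; exact h
  clear h
  revert c
  decide

/-- A matrix is homogeneous of degree zero for the weights `wt`. -/
def Graded (M : Matrix ι ι ℂ) (wt : ι → ZMod 4) : Prop := ∀ a b, wt a ≠ wt b → M a b = 0

lemma graded_of_eq {M : Matrix ι ι ℂ} {wt : ι → ZMod 4}
    (h : ∀ a b, M a b = χ (wt a - wt b) * M a b) : Graded M wt := by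
  intro a b hab
  by_contra h0
  refine hab (sub_eq_zero.1 (eq_zero_of_χ_eq_one ?_))
  have := h a b
  nth_rewrite 1 [← one_mul (M a b)] at this
  exact (mul_right_cancel₀ h0 this).symm

/-- The part of weight `c` of a matrix. -/
def wtBlock (M : Matrix ι ι ℂ) (wt : ι → ZMod 4) (c : ZMod 4) :
    Matrix {a // wt a = c} {a // wt a = c} ℂ :=
  M.submatrix Subtype.val Subtype.val

/-- The positive index of inertia of a graded Hermitian matrix, as a character. -/
noncomputable def posg (M : Matrix ι ι ℂ) (wt : ι → ZMod 4) : GaussianInt :=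
  ∑ c, i4 c * posIdx (wtBlock M wt c)

section Extend

variable (wt : ι → ZMod 4) (c : ZMod 4)

/-- Extension by zero of a vector supported on the part of weight `c`. -/
def wtExtend (ξ : {a // wt a = c} → ℂ) (a : ι) : ℂ := if h : wt a = c then ξ ⟨a, h⟩ else 0

variable {wt c}

lemma sum_wtExtend {R : Type*} [AddCommMonoid R] (F : ι → R) (hF : ∀ a, wt a ≠ c → F a = 0) :
    ∑ a, F a = ∑ a : {a // wt a = c}, F a := by
  rw [← Finset.sum_subtype (Finset.univ.filter fun a => wt a = c) (by simp) F]
  symm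
  apply Finset.sum_subset (Finset.filter_subset _ _)
  intro a _ ha
  exact hF a (by simpa using ha)

lemma wtExtend_coe (ξ : {a // wt a = c} → ℂ) (a : {a // wt a = c}) : wtExtend wt c ξ a = ξ a := by
  simp [wtExtend, a.2]

lemma wtExtend_of_ne (ξ : {a // wt a = c} → ℂ) {a : ι} (h : wt a ≠ c) :
    wtExtend wt c ξ a = 0 := by
  simp [wtExtend, h]

lemma eNorm_wtExtend (ξ : {a // wt a = c} → ℂ) : eNorm (wtExtend wt c ξ) = eNorm ξ := by
  rw [← sq_eq_sq₀ (eNorm_nonneg _) (eNorm_nonneg _), eNorm_sq, eNorm_sq,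
    sum_wtExtend (wt := wt) (c := c)]
  · simp [wtExtend_coe]
  · intro a ha; simp [wtExtend_of_ne _ ha]

lemma mulVec_wtExtend_coe (M : Matrix ι ι ℂ) (ξ : {a // wt a = c} → ℂ) (a : {a // wt a = c}) :
    (M *ᵥ wtExtend wt c ξ) a = (wtBlock M wt c *ᵥ ξ) a := by
  simp only [mulVec, dotProduct]
  rw [sum_wtExtend (wt := wt) (c := c)]
  · simp [wtExtend_coe, wtBlock]
  · intro a ha; simp [wtExtend_of_ne _ ha]

lemma mulVec_wtExtend {M : Matrix ι ι ℂ} (hM : Graded M wt) (ξ : {a // wt a = c} → ℂ) :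
    M *ᵥ wtExtend wt c ξ = wtExtend wt c (wtBlock M wt c *ᵥ ξ) := by
  ext a
  by_cases h : wt a = c
  · rw [wtExtend_coe _ ⟨a, h⟩, mulVec_wtExtend_coe M ξ ⟨a, h⟩]
  · rw [wtExtend_of_ne _ h]
    simp only [mulVec, dotProduct]
    refine Finset.sum_eq_zero fun b _ => ?_
    by_cases hb : wt b = c
    · rw [hM a b (by rw [hb]; exact h), zero_mul]
    · rw [wtExtend_of_ne _ hb, mul_zero]

lemma qForm_wtExtend (M : Matrix ι ι ℂ) (ξ : {a // wt a = c} → ℂ) :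
    qForm M (wtExtend wt c ξ) = qForm (wtBlock M wt c) ξ := by
  simp only [qForm, dotProduct]
  rw [sum_wtExtend (wt := wt) (c := c)]
  · simp only [mulVec_wtExtend_coe, Pi.star_apply, wtExtend_coe]
  · intro a ha; simp [wtExtend_of_ne _ ha]

end Extend

lemma BoundedBelow.wtBlock {M : Matrix ι ι ℂ} {r : ℝ} (hb : BoundedBelow M r)
    {wt : ι → ZMod 4} (hM : Graded M wt) (c : ZMod 4) : BoundedBelow (wtBlock M wt c) r := by
  intro ξ
  have := hb (wtExtend wt c ξ)
  rwa [mulVec_wtExtend hM, eNorm_wtExtend, eNorm_wtExtend] at this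

lemma posg_eq_of_close {M M' : Matrix ι ι ℂ} {wt : ι → ZMod 4} (hM : M.IsHermitian)
    (hg : Graded M wt) {r : ℝ} (hb : BoundedBelow M r) (h : ‖M' - M‖ < r) :
    posg M' wt = posg M wt := by
  refine Finset.sum_congr rfl fun c _ => ?_
  rw [posIdx_eq_of_close (M' := wtBlock M' wt c) (hM.submatrix _) (hb.wtBlock hg c) ?_]
  · rfl
  intro ξ hξ
  change |qForm (wtBlock M' wt c) ξ - qForm (wtBlock M wt c) ξ| < _
  rw [← qForm_wtExtend, ← qForm_wtExtend, ← eNorm_wtExtend (wt := wt)]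
  have h1 := qForm_add (M' - M) M (wtExtend wt c ξ)
  rw [sub_add_cancel] at h1
  rw [h1, add_sub_cancel_right]
  refine (abs_qForm_le _ _).trans_lt ?_
  gcongr
  rw [eNorm_wtExtend]
  exact pow_pos (eNorm_pos hξ) 2

lemma posg_sum (e : α ⊕ β ≃ ι) {M : Matrix ι ι ℂ} {wt : ι → ZMod 4} (hM : M.IsHermitian)
    (hg : Graded M wt) (h0 : ∀ a b, M (e (.inl a)) (e (.inr b)) = 0) {r : ℝ} (hr : 0 < r)
    (hb : BoundedBelow M r) :
    posg M wt = posg (M.submatrix (e ∘ .inl) (e ∘ .inl)) (wt ∘ e ∘ .inl) +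
      posg (M.submatrix (e ∘ .inr) (e ∘ .inr)) (wt ∘ e ∘ .inr) := by
  simp only [posg]
  rw [← Finset.sum_add_distrib]
  refine Finset.sum_congr rfl fun c _ => ?_
  let e' : {a // (wt ∘ e ∘ .inl) a = c} ⊕ {b // (wt ∘ e ∘ .inr) b = c} ≃ {i // wt i = c} :=
    (Equiv.subtypeSum (p := fun s => wt (e s) = c)).symm.trans
      (e.subtypeEquiv fun s => Iff.rfl)
  rw [posIdx_sum e' (M := wtBlock M wt c) (hM.submatrix _) (fun a b => h0 a.1 b.1) hr
    (hb.wtBlock hg c), ← mul_add, ← Nat.cast_add]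
  rfl

lemma posIdx_submatrix_congr (M : Matrix ι ι ℂ) (p q : ι → Prop) [DecidablePred p]
    [DecidablePred q] (h : p = q) :
    posIdx (M.submatrix (Subtype.val : {a // p a} → ι) Subtype.val) =
      posIdx (M.submatrix (Subtype.val : {a // q a} → ι) Subtype.val) := by
  subst h
  congr!

lemma posg_shift (M : Matrix ι ι ℂ) (wt : ι → ZMod 4) (s : ZMod 4) :
    posg M (fun a => wt a + s) = i4 s * posg M wt := by
  have h : ∀ c d, d + s = c →
      posIdx (wtBlock M (fun a => wt a + s) c) = posIdx (wtBlock M wt d) := by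
    rintro c d rfl
    exact posIdx_submatrix_congr M _ _ (funext fun a => propext (add_left_inj s))
  simp only [posg]
  rw [← Equiv.sum_comp (Equiv.addRight s), Finset.mul_sum]
  refine Finset.sum_congr rfl fun c _ => ?_
  rw [Equiv.coe_addRight, h _ c rfl, AddChar.map_add_eq_mul]
  ring

lemma posIdx_of_pos {M : Matrix ι ι ℂ} (h : ∀ ξ, ξ ≠ 0 → 0 < qForm M ξ) :
    posIdx M = Fintype.card ι := by
  rw [posIdx_eq (P := ⊤) (N := ⊥) (fun ξ _ => h ξ)]
  · simp
  · rintro ξ rfl; simp [qForm]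
  · simp

lemma posIdx_of_nonpos {M : Matrix ι ι ℂ} (h : ∀ ξ, qForm M ξ ≤ 0) : posIdx M = 0 := by
  rw [posIdx_eq (P := ⊥) (N := ⊤)]
  · simp
  · rintro ξ rfl; simp
  · exact fun ξ _ => h ξ
  · simp

end GradedIndex

section MatrixNorms

variable {ι κ α β : Type*} [Fintype ι] [DecidableEq ι] [Fintype κ] [DecidableEq κ]
  [Fintype α] [DecidableEq α] [Fintype β] [DecidableEq β]

lemma norm_le_of_gram {A : Matrix α ι ℂ} {d : ι → ℂ} (h : Aᴴ * A = diagonal d) {ε : ℝ}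
    (hε : 0 ≤ ε) (hd : ∀ i, ‖d i‖ ≤ ε ^ 2) : ‖A‖ ≤ ε := by
  have h1 := l2_opNorm_conjTranspose_mul_self A
  rw [h, l2_opNorm_diagonal] at h1
  have h2 : ‖d‖ ≤ ε ^ 2 := (pi_norm_le_iff_of_nonneg (by positivity)).2 hd
  nlinarith [norm_nonneg A]

lemma norm_isometry_le {A : Matrix α ι ℂ} (h : Aᴴ * A = 1) : ‖A‖ ≤ 1 :=
  norm_le_of_gram (d := fun _ => 1) (by rw [h, diagonal_one]) zero_le_one (by simp)

/-- The matrix of the inclusion of basis vectors given by a map of index sets. -/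
def emb (f : α → ι) : Matrix ι α ℂ := (1 : Matrix ι ι ℂ).submatrix id f

lemma norm_emb_le {f : α → ι} (hf : Function.Injective f) : ‖emb f‖ ≤ 1 := by
  apply norm_isometry_le
  ext i j
  simp [emb, mul_apply, one_apply, hf.eq_iff, eq_comm]

lemma norm_emb_mul_mul_le {f : α → ι} {g : β → κ} (hf : Function.Injective f)
    (hg : Function.Injective g) (A : Matrix α β ℂ) : ‖emb f * A * (emb g)ᴴ‖ ≤ ‖A‖ := by
  calc ‖emb f * A * (emb g)ᴴ‖ ≤ ‖emb f‖ * ‖A‖ * ‖(emb g)ᴴ‖ :=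
        (l2_opNorm_mul _ _).trans (by gcongr; exact l2_opNorm_mul _ _)
    _ ≤ 1 * ‖A‖ * 1 := by
        rw [l2_opNorm_conjTranspose]
        gcongr
        · exact norm_emb_le hf
        · exact norm_emb_le hg
    _ = ‖A‖ := by ring

/-- The matrix with blocks `D a b`. -/
def blk (D : ι → ι → Matrix α β ℂ) : Matrix (ι × α) (ι × β) ℂ :=
  of fun p q => D p.1 q.1 p.2 q.2

lemma norm_blk_le (D : ι → ι → Matrix α β ℂ) : ‖blk D‖ ≤ ∑ a, ∑ b, ‖D a b‖ := by
  have h : blk D = ∑ a, ∑ b, emb (fun i : α => (a, i)) * D a b *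
      (emb (fun j : β => (b, j)) : Matrix (ι × β) β ℂ)ᴴ := by
    ext ⟨a, i⟩ ⟨b, j⟩
    simp only [blk, of_apply, Matrix.sum_apply]
    rw [Finset.sum_eq_single a, Finset.sum_eq_single b]
    · simp [emb, mul_apply, one_apply]
    · intro b' _ hb'
      simp [emb, mul_apply, one_apply, hb']
    · simp
    · intro a' _ ha'
      refine Finset.sum_eq_zero fun b' _ => ?_
      simp [emb, mul_apply, one_apply, ha'.symm]
    · simp
  rw [h]
  refine (norm_sum_le _ _).trans (Finset.sum_le_sum fun a _ => ?_)
  refine (norm_sum_le _ _).trans (Finset.sum_le_sum fun b _ => ?_)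
  exact norm_emb_mul_mul_le (Prod.mk_right_injective a) (Prod.mk_right_injective b) _

/-- Direct sum of a matrix and a scalar, transported along a bijection of index sets. -/
def extend (e : α ⊕ Unit ≃ β) (A : Matrix α α ℂ) (z : ℂ) : Matrix β β ℂ :=
  (fromBlocks A 0 0 (diagonal fun _ => z)).submatrix e.symm e.symm

lemma extend_add (e : α ⊕ Unit ≃ β) (A B : Matrix α α ℂ) (y z : ℂ) :
    extend e (A + B) (y + z) = extend e A y + extend e B z := by
  ext i j
  obtain ⟨i, rfl⟩ := e.surjective i
  obtain ⟨j, rfl⟩ := e.surjective j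
  rcases i with i | i <;> rcases j with j | j <;> simp [extend]

lemma extend_mul (e : α ⊕ Unit ≃ β) (A B : Matrix α α ℂ) (y z : ℂ) :
    extend e (A * B) (y * z) = extend e A y * extend e B z := by
  simp [extend, fromBlocks_multiply]

lemma extend_smul_one (e : α ⊕ Unit ≃ β) (z : ℂ) : extend e (z • 1) z = z • 1 := by
  have h : (diagonal fun _ : Unit => z) = z • (1 : Matrix Unit Unit ℂ) := by
    rw [smul_one_eq_diagonal]
  rw [extend, h]
  have := fromBlocks_smul z (1 : Matrix α α ℂ) 0 0 (1 : Matrix Unit Unit ℂ)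
  rw [smul_zero, smul_zero] at this
  rw [← this, fromBlocks_one, submatrix_smul]
  simp

lemma norm_extend_le (e : α ⊕ Unit ≃ β) (A : Matrix α α ℂ) (z : ℂ) :
    ‖extend e A z‖ ≤ ‖A‖ + ‖z‖ := by
  have h : extend e A z = emb (e ∘ .inl) * A * (emb (e ∘ .inl))ᴴ +
      emb (e ∘ .inr) * (diagonal fun _ => z : Matrix Unit Unit ℂ) * (emb (e ∘ .inr))ᴴ := by
    ext i j
    obtain ⟨i, rfl⟩ := e.surjective i
    obtain ⟨j, rfl⟩ := e.surjective j
    rcases i with i | i <;> rcases j with j | j <;>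
      simp [extend, emb, mul_apply, one_apply]
  rw [h]
  refine (norm_add_le _ _).trans (add_le_add ?_ ?_)
  · exact norm_emb_mul_mul_le (e.injective.comp Sum.inl_injective)
      (e.injective.comp Sum.inl_injective) A
  · refine (norm_emb_mul_mul_le (e.injective.comp Sum.inr_injective)
      (e.injective.comp Sum.inr_injective) _).trans ?_
    rw [l2_opNorm_diagonal]
    simp

/-- Direct sum decomposition of `Fin (n + 1)` whose scalar part is the last index. -/
def eLast (n : ℕ) : Fin n ⊕ Unit ≃ Fin (n + 1) :=
  (finSuccEquivLast.trans (Equiv.optionEquivSumPUnit _)).symm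

/-- Direct sum decomposition of `Fin (n + 1)` whose scalar part is the first index. -/
def eFirst (n : ℕ) : Fin n ⊕ Unit ≃ Fin (n + 1) :=
  ((finSuccEquiv n).trans (Equiv.optionEquivSumPUnit _)).symm

/-- A weighted shift by `δ`. -/
def shift (n : ℕ) (V : ℕ → ℂ) (δ : ℤ) : Matrix (Fin n) (Fin n) ℂ :=
  of fun k l => if (k : ℤ) = l + δ then V l else 0

lemma norm_shift_le {n : ℕ} {V : ℕ → ℂ} {δ : ℤ} {ε : ℝ} (hε : 0 ≤ ε) (hV : ∀ l, ‖V l‖ ≤ ε) :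
    ‖shift n V δ‖ ≤ ε := by
  refine norm_le_of_gram (d := fun l => ((shift n V δ)ᴴ * shift n V δ) l l) ?_ hε ?_
  · ext k l
    rw [diagonal_apply]
    split_ifs with h
    · rw [h]
    · rw [mul_apply]
      refine Finset.sum_eq_zero fun j _ => ?_
      simp only [shift, conjTranspose_apply, of_apply]
      split_ifs with h1 h2
      · exact absurd (Fin.ext (by omega)) h
      all_goals simp
  · intro l
    rw [mul_apply]
    by_cases h : ∃ j : Fin n, (j : ℤ) = l + δ
    · obtain ⟨j, hj⟩ := h
      rw [Finset.sum_eq_single j]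
      · simp only [shift, conjTranspose_apply, of_apply, hj, if_true, norm_mul, norm_star]
        nlinarith [hV l, norm_nonneg (V l)]
      · intro k _ hk
        have : (k : ℤ) ≠ l + δ := fun h => hk (Fin.ext (by omega))
        simp [shift, this]
      · simp
    · push Not at h
      simp [shift, h, sq_nonneg]

lemma extend_eLast_shift {n : ℕ} {V : ℕ → ℂ} {δ : ℤ} (hδ : |δ| ≤ 1)
    (h : δ ≠ 0 → V n = 0 ∧ V (n + 1) = 0) :
    extend (eLast (n + 1)) (shift (n + 1) V δ) (if δ = 0 then V (n + 1) else 0) =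
      shift (n + 2) V δ := by
  rw [abs_le] at hδ
  ext k l
  induction k using Fin.lastCases <;> induction l using Fin.lastCases
  · simp [extend, eLast, shift]
  · rename_i l
    simp [extend, eLast, shift]
    intro h1
    rw [show (l : ℕ) = n by omega]
    exact (h (by omega)).1.symm
  · rename_i l
    simp [extend, eLast, shift]
    intro h1
    exact (h (by omega)).2.symm
  · simp [extend, eLast, shift]

lemma extend_eFirst_shift {n : ℕ} {V : ℕ → ℂ} {δ : ℤ} (hδ : |δ| ≤ 1)
    (h : δ ≠ 0 → V 0 = 0) :
    extend (eFirst (n + 1)) (shift (n + 1) V δ) (if δ = 0 then V 0 else 0) =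
      shift (n + 2) (fun l => V (l - 1)) δ := by
  rw [abs_le] at hδ
  ext k l
  induction k using Fin.cases <;> induction l using Fin.cases
  · simp [extend, eFirst, shift, eq_comm]
  · rename_i l
    simp [extend, eFirst, shift]
    intro h1
    rw [show (l : ℕ) = 0 by omega]
    exact (h (by omega)).symm
  · rename_i l
    simp [extend, eFirst, shift]
    intro h1
    exact (h (by omega)).symm
  · simp [extend, eFirst, shift, add_right_comm]

end MatrixNorms

section Waves

instance (N : ℕ) : NeZero (4 * (N + 2)) := ⟨by omega⟩

/-- The group of roots of unity discretising the circle. -/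
abbrev Mu (N : ℕ) : Type := ↥(rootsOfUnity (4 * (N + 2)) ℂ)

noncomputable instance (N : ℕ) : Fintype (Mu N) := Fintype.ofFinite _

lemma norm_Mu {N : ℕ} (ζ : Mu N) : ‖((ζ : ℂˣ) : ℂ)‖ = 1 := by
  have h : ((ζ : ℂˣ) : ℂ) ^ (4 * (N + 2)) = 1 := by
    have := (mem_rootsOfUnity _ _).1 ζ.2
    simpa using congrArg Units.val this
  exact Complex.norm_eq_one_of_pow_eq_one h (by omega)

lemma sum_zpow_Mu {N : ℕ} {d : ℤ} (hd : |d| ≤ N) :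
    ∑ ζ : Mu N, ((ζ : ℂˣ) : ℂ) ^ d = if d = 0 then ((4 * (N + 2) : ℕ) : ℂ) else 0 := by
  classical
  let φ : Mu N →* ℂ := (Units.coeHom ℂ).comp ((rootsOfUnity _ ℂ).subtype.comp (zpowGroupHom d))
  have h1 := sum_hom_units φ
  have h2 : ∀ ζ : Mu N, φ ζ = ((ζ : ℂˣ) : ℂ) ^ d := fun ζ => by simp [φ]
  simp only [h2] at h1
  rw [h1, ← Nat.card_eq_fintype_card, Complex.card_rootsOfUnity]
  have hφ : φ = 1 ↔ d = 0 := by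
    constructor
    · intro h
      have hp := Complex.isPrimitiveRoot_exp (4 * (N + 2)) (by omega)
      have h3 := DFunLike.congr_fun h hp.toRootsOfUnity
      rw [h2, MonoidHom.one_apply, IsPrimitiveRoot.val_toRootsOfUnity_coe,
        hp.zpow_eq_one_iff_dvd] at h3
      refine Int.eq_zero_of_abs_lt_dvd h3 (hd.trans_lt ?_)
      push_cast
      omega
    · rintro rfl
      ext ζ
      simp [h2]
  simp only [hφ, Nat.cast_ite, Nat.cast_zero]

/-- Matrices whose columns are wave packets: the column of index `l` has profile `c l` in the
radial direction and frequency `l + δ` in the angular direction. -/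
noncomputable def waveMat (N w : ℕ) (c : ℕ → ℕ → ℂ) (δ : ℤ) :
    Matrix (Fin (N + w) × Mu N) (Fin (N + 1)) ℂ :=
  of fun q l => c l q.1 * ((q.2 : ℂˣ) : ℂ) ^ ((l : ℤ) + δ) / (√(4 * (N + 2) : ℕ) : ℝ)

lemma waveMat_gram (N w : ℕ) (c : ℕ → ℕ → ℂ) (δ : ℤ) :
    (waveMat N w c δ)ᴴ * waveMat N w c δ =
      diagonal fun l : Fin (N + 1) => ((∑ p : Fin (N + w), ‖c l p‖ ^ 2 : ℝ) : ℂ) := by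
  ext k l
  set s : ℂ := ((√(4 * (N + 2) : ℕ) : ℝ) : ℂ) with hs
  have hss : s * s = ((4 * (N + 2) : ℕ) : ℂ) := by
    rw [hs, ← Complex.ofReal_mul, Real.mul_self_sqrt (by positivity)]
    simp
  have hs0 : s ≠ 0 := by
    intro h
    rw [h, mul_zero] at hss
    exact absurd hss.symm (Nat.cast_ne_zero.2 (by omega))
  have hterm : ∀ (p : Fin (N + w)) (ζ : Mu N),
      star (waveMat N w c δ (p, ζ) k) * waveMat N w c δ (p, ζ) l =
        (star (c k p) * c l p / (s * s)) * ((ζ : ℂˣ) : ℂ) ^ ((l : ℤ) - k) := by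
    intro p ζ
    have hζ : ((ζ : ℂˣ) : ℂ) ≠ 0 := Units.ne_zero _
    have hst : star (((ζ : ℂˣ) : ℂ) ^ ((k : ℤ) + δ)) = ((ζ : ℂˣ) : ℂ) ^ (-((k : ℤ) + δ)) := by
      have h1 : star ((ζ : ℂˣ) : ℂ) = ((ζ : ℂˣ) : ℂ)⁻¹ := by
        rw [Complex.inv_eq_conj (norm_Mu ζ)]
        rfl
      rw [star_zpow₀, h1, _root_.inv_zpow, _root_.zpow_neg]
    have hsr : star s = s := by rw [hs]; exact Complex.conj_ofReal _
    simp only [waveMat, of_apply, star_div₀, star_mul', hst]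
    rw [← hs, hsr, show (l : ℤ) - k = -((k : ℤ) + δ) + (l + δ) by ring,
      zpow_add₀ hζ (-((k : ℤ) + δ))]
    ring
  rw [mul_apply, Fintype.sum_prod_type]
  simp only [conjTranspose_apply, hterm, ← Finset.mul_sum]
  rw [sum_zpow_Mu (by rw [abs_le]; omega), diagonal_apply]
  by_cases h : k = l
  · subst h
    simp only [sub_self, if_true, ← hss]
    push_cast
    refine Finset.sum_congr rfl fun p _ => ?_
    rw [div_mul_cancel₀ _ (mul_ne_zero hs0 hs0), ← Complex.conj_mul']
    rfl
  · have : (l : ℤ) - k ≠ 0 := fun h' => h (Fin.ext (by omega))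
    simp [h, this]

lemma norm_waveMat_le {N w : ℕ} {c : ℕ → ℕ → ℂ} {δ : ℤ} {ε : ℝ} (hε : 0 ≤ ε)
    (h : ∀ l : Fin (N + 1), ∑ p : Fin (N + w), ‖c l p‖ ^ 2 ≤ ε ^ 2) : ‖waveMat N w c δ‖ ≤ ε := by
  refine norm_le_of_gram (waveMat_gram N w c δ) hε fun l => ?_
  rw [Complex.norm_real, Real.norm_of_nonneg (by positivity)]
  exact h l

lemma waveMat_sub (N w : ℕ) (c c' : ℕ → ℕ → ℂ) (δ : ℤ) :
    waveMat N w c δ - waveMat N w c' δ = waveMat N w (fun l p => c l p - c' l p) δ := by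
  ext q l
  simp only [waveMat, Matrix.sub_apply, of_apply]
  ring

/-- The normalised indicator function of the window `[k, k + w)`. -/
noncomputable def window (w : ℕ) (k : ℤ) (p : ℕ) : ℂ :=
  if k ≤ p ∧ (p : ℤ) < k + w then ((√w)⁻¹ : ℝ) else 0

/-- The isometry whose columns are the basic wave packets. -/
noncomputable def packet (N w : ℕ) : Matrix (Fin (N + w) × Mu N) (Fin (N + 1)) ℂ :=
  waveMat N w (fun l => window w l) 0

lemma norm_window_sq (w : ℕ) (k : ℤ) (p : ℕ) :
    ‖window w k p‖ ^ 2 = if k ≤ p ∧ (p : ℤ) < k + w then (w : ℝ)⁻¹ else 0 := by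
  unfold window
  split_ifs
  · rw [Complex.norm_real, Real.norm_of_nonneg (by positivity), inv_pow, Real.sq_sqrt (by simp)]
  · simp

lemma sum_norm_window_sq {N w : ℕ} (hw : 0 < w) (l : Fin (N + 1)) :
    ∑ p : Fin (N + w), ‖window w l p‖ ^ 2 = 1 := by
  simp only [norm_window_sq]
  rw [Fin.sum_univ_eq_sum_range
    (fun p => if (l : ℤ) ≤ p ∧ (p : ℤ) < l + w then (w : ℝ)⁻¹ else 0), ← Finset.sum_filter,
    Finset.sum_const, nsmul_eq_mul]
  have : (Finset.range (N + w)).filter (fun p : ℕ => ((l : ℕ) : ℤ) ≤ p ∧ (p : ℤ) < (l : ℕ) + w) =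
      Finset.Ico (l : ℕ) (l + w) := by
    ext p
    simp only [Finset.mem_filter, Finset.mem_range, Finset.mem_Ico]
    omega
  rw [this, Nat.card_Ico, Nat.add_sub_cancel_left]
  exact mul_inv_cancel₀ (by positivity)

lemma packet_isometry (N : ℕ) {w : ℕ} (hw : 0 < w) : (packet N w)ᴴ * packet N w = 1 := by
  rw [packet, waveMat_gram, ← diagonal_one]
  congr 1
  ext l
  rw [sum_norm_window_sq hw, Complex.ofReal_one]

end Waves

section Sphere

/-- A model of the Riemann sphere, parametrised by a height and a horizontal coordinate. -/
abbrev Sph : Type := {y : ℝ × ℂ // (0 ≤ y.1 ∧ y.1 ≤ 1) ∧ ‖y.2‖ = y.1 * (1 - y.1)}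

instance : CompactSpace Sph := by
  apply isCompact_iff_compactSpace.1
  apply Metric.isCompact_of_isClosed_isBounded
  · refine IsClosed.inter (IsClosed.inter ?_ ?_) ?_
    · exact isClosed_le continuous_const continuous_fst
    · exact isClosed_le continuous_fst continuous_const
    · exact isClosed_eq (by fun_prop) (by fun_prop)
  · refine (Metric.isBounded_closedBall (x := (0 : ℝ × ℂ)) (r := 1)).subset ?_
    rintro ⟨r, z⟩ ⟨⟨h1, h2⟩, h3⟩
    simp only at h1 h2 h3
    rw [mem_closedBall_zero_iff, Prod.norm_def, max_le_iff]
    refine ⟨?_, ?_⟩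
    · rw [Real.norm_eq_abs, abs_le]
      constructor <;> linarith
    · rw [h3]
      nlinarith

/-- The point of height `0`. -/
def south : Sph := ⟨(0, 0), by simp⟩

/-- The point of height `1`. -/
def north : Sph := ⟨(1, 0), by simp⟩

/-- Rotation of the sphere by `i ^ c`. -/
noncomputable def rot (c : ZMod 4) (y : Sph) : Sph :=
  ⟨(y.1.1, χ c * y.1.2), y.2.1, by rw [norm_mul, norm_χ, one_mul]; exact y.2.2⟩

lemma rot_south (c : ZMod 4) : rot c south = south := by simp [rot, south]

lemma rot_north (c : ZMod 4) : rot c north = north := by simp [rot, north]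

/-- The heights of the circles discretising the sphere. -/
noncomputable def rad (N p : ℕ) : ℝ := min (p / N) 1

lemma rad_nonneg (N p : ℕ) : 0 ≤ rad N p := le_min (by positivity) zero_le_one

lemma rad_le_one (N p : ℕ) : rad N p ≤ 1 := min_le_right _ _

lemma rad_zero (N : ℕ) : rad N 0 = 0 := by simp [rad]

lemma rad_eq_one {N p : ℕ} (hN : 0 < N) (h : N ≤ p) : rad N p = 1 := by
  apply min_eq_right
  rw [one_le_div (by positivity)]
  exact_mod_cast h

lemma abs_rad_sub_rad_le (N p q : ℕ) : |rad N p - rad N q| ≤ |(p : ℝ) - q| / N := by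
  have h := abs_min_sub_min_le_max ((p : ℝ) / N) 1 (q / N) 1
  rw [sub_self, abs_zero, max_eq_left (abs_nonneg _), ← sub_div, abs_div, Nat.abs_cast] at h
  exact h

/-- The radii of the circles discretising the sphere. -/
noncomputable def prof (N p : ℕ) : ℝ := rad N p * (1 - rad N p)

lemma prof_nonneg (N p : ℕ) : 0 ≤ prof N p :=
  mul_nonneg (rad_nonneg N p) (sub_nonneg.2 (rad_le_one N p))

lemma prof_le_one (N p : ℕ) : prof N p ≤ 1 := by
  have h1 := rad_nonneg N p
  have h2 := rad_le_one N p
  unfold prof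
  nlinarith

lemma abs_prof_sub_prof_le (N p q : ℕ) : |prof N p - prof N q| ≤ |(p : ℝ) - q| / N := by
  refine le_trans ?_ (abs_rad_sub_rad_le N p q)
  have h1 := rad_nonneg N p
  have h2 := rad_le_one N p
  have h3 := rad_nonneg N q
  have h4 := rad_le_one N q
  have h : prof N p - prof N q = (rad N p - rad N q) * (1 - rad N p - rad N q) := by
    unfold prof; ring
  rw [h, abs_mul]
  refine mul_le_of_le_one_right (abs_nonneg _) ?_
  rw [abs_le]
  constructor <;> linarith

/-- The points discretising the sphere. -/
noncomputable def pt (N w : ℕ) (q : Fin (N + w) × Mu N) : Sph :=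
  ⟨(rad N q.1, prof N q.1 * ((q.2 : ℂˣ) : ℂ)), ⟨rad_nonneg _ _, rad_le_one _ _⟩, by
    rw [norm_mul, norm_Mu, mul_one, Complex.norm_real, Real.norm_of_nonneg (prof_nonneg _ _)]
    rfl⟩

/-- The diagonal matrix of values of a function on the discretised sphere. -/
noncomputable def diagF (N w : ℕ) (g : Sph → ℂ) :
    Matrix (Fin (N + w) × Mu N) (Fin (N + w) × Mu N) ℂ :=
  diagonal fun q => g (pt N w q)

lemma norm_diagF_le (N w : ℕ) {g : Sph → ℂ} {C : ℝ} (hC : 0 ≤ C) (h : ∀ s, ‖g s‖ ≤ C) :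
    ‖diagF N w g‖ ≤ C := by
  rw [diagF, l2_opNorm_diagonal]
  exact (pi_norm_le_iff_of_nonneg hC).2 fun q => h _

lemma norm_window_sub_sq_le {w : ℕ} {V : ℕ → ℝ} (hV : ∀ p, 0 ≤ V p ∧ V p ≤ 1) {N : ℕ}
    (hL : ∀ p q : ℕ, |V p - V q| ≤ |(p : ℝ) - q| / N) {δ : ℤ} (hδ : |δ| ≤ 1) (l p : ℕ) :
    ‖V p * window w l p - V l * window w (l + δ) p‖ ^ 2 ≤ (w / N : ℝ) ^ 2 * ‖window w l p‖ ^ 2 +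
      if (p : ℤ) ∈ ({(l : ℤ) - 1, (l : ℤ), (l : ℤ) + w - 1, (l : ℤ) + w} : Finset ℤ)
        then (w : ℝ)⁻¹ else 0 := by
  have hsq : ∀ x : ℝ, ‖((x * (√w)⁻¹ : ℝ) : ℂ)‖ ^ 2 = x ^ 2 * (w : ℝ)⁻¹ := by
    intro x
    rw [Complex.norm_real, Real.norm_eq_abs, sq_abs, mul_pow, inv_pow, Real.sq_sqrt (by simp)]
  have hc : ((V p : ℂ) * window w l p - V l * window w (l + δ) p) =
      (((V p * (if (l : ℤ) ≤ p ∧ (p : ℤ) < l + w then 1 else 0) -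
        V l * (if (l + δ : ℤ) ≤ p ∧ (p : ℤ) < l + δ + w then 1 else 0)) * (√w)⁻¹ : ℝ) : ℂ) := by
    simp only [window]
    split_ifs <;> push_cast <;> ring
  rw [hc, hsq, norm_window_sq]
  rw [abs_le] at hδ
  have hw : (0 : ℝ) ≤ (w : ℝ)⁻¹ := by positivity
  obtain ⟨hp0, hp1⟩ := hV p
  obtain ⟨hl0, hl1⟩ := hV l
  by_cases hT : (p : ℤ) ∈ ({(l : ℤ) - 1, (l : ℤ), (l : ℤ) + w - 1, (l : ℤ) + w} : Finset ℤ)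
  · rw [if_pos hT]
    refine le_add_of_nonneg_of_le (by positivity) ?_
    refine mul_le_of_le_one_left hw ?_
    rw [sq_le_one_iff_abs_le_one, abs_le]
    split_ifs <;> constructor <;> linarith
  · rw [if_neg hT, add_zero]
    simp only [Finset.mem_insert, Finset.mem_singleton, not_or] at hT
    by_cases h : (l : ℤ) ≤ p ∧ (p : ℤ) < l + w
    · have h' : (l + δ : ℤ) ≤ p ∧ (p : ℤ) < l + δ + w := by omega
      rw [if_pos h, if_pos h', if_pos h, mul_one, mul_one]
      gcongr ?_ * _
      rw [← sq_abs]
      gcongr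
      refine (hL p l).trans ?_
      gcongr
      rw [abs_le]
      have h1 : (l : ℝ) ≤ p := by exact_mod_cast h.1
      have h2 : (p : ℝ) < l + w := by exact_mod_cast h.2
      constructor <;> linarith
    · have h' : ¬ ((l + δ : ℤ) ≤ p ∧ (p : ℤ) < l + δ + w) := by omega
      rw [if_neg h, if_neg h', if_neg h]
      simp

lemma diagF_mul_packet_sub {N w : ℕ} {V : ℕ → ℝ} {δ : ℤ} (hδ : |δ| ≤ 1)
    (h0 : δ ≠ 0 → V 0 = 0 ∧ V N = 0) {g : Sph → ℂ}
    (hg : ∀ q, g (pt N w q) = V q.1 * ((q.2 : ℂˣ) : ℂ) ^ δ) :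
    diagF N w g * packet N w - packet N w * shift (N + 1) (fun l => V l) δ =
      waveMat N w (fun l p => V p * window w l p - V l * window w (l + δ) p) δ := by
  rw [abs_le] at hδ
  rw [← waveMat_sub]
  congr 1
  · ext q l
    have hζ : ((q.2 : ℂˣ) : ℂ) ≠ 0 := Units.ne_zero _
    simp only [diagF, diagonal_mul, packet, waveMat, of_apply, hg, zpow_add₀ hζ, zpow_zero]
    ring
  · ext q l
    rw [mul_apply]
    by_cases h : ∃ k : Fin (N + 1), (k : ℤ) = l + δ
    · obtain ⟨k, hk⟩ := h
      rw [Finset.sum_eq_single k]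
      · simp only [packet, waveMat, of_apply, shift, hk, if_true, add_zero]
        ring
      · intro j _ hj
        have : (j : ℤ) ≠ l + δ := fun h => hj (Fin.ext (by omega))
        simp [shift, this]
      · simp
    · push Not at h
      have hV : V l = 0 := by
        have h1 : (l : ℤ) + δ < 0 ∨ (N : ℤ) < l + δ := by
          by_contra! hcon
          refine h ⟨(l + δ : ℤ).toNat, by omega⟩ ?_
          simp only
          omega
        have h2 := l.2
        have h3 := h0 (by omega)
        have h4 : (l : ℕ) = 0 ∨ (l : ℕ) = N := by omega
        rcases h4 with h4 | h4 <;> rw [h4]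
        exacts [h3.1, h3.2]
      simp [waveMat, shift, h, hV]

lemma norm_diagF_mul_packet_sub_le {N w : ℕ} (hw : 0 < w) {V : ℕ → ℝ}
    (hV : ∀ p, 0 ≤ V p ∧ V p ≤ 1) (hL : ∀ p q : ℕ, |V p - V q| ≤ |(p : ℝ) - q| / N) {δ : ℤ}
    (hδ : |δ| ≤ 1) (h0 : δ ≠ 0 → V 0 = 0 ∧ V N = 0) {g : Sph → ℂ}
    (hg : ∀ q, g (pt N w q) = V q.1 * ((q.2 : ℂˣ) : ℂ) ^ δ) :
    ‖diagF N w g * packet N w - packet N w * shift (N + 1) (fun l => V l) δ‖ ≤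
      √((w / N : ℝ) ^ 2 + 4 * (w : ℝ)⁻¹) := by
  rw [diagF_mul_packet_sub hδ h0 hg]
  refine norm_waveMat_le (Real.sqrt_nonneg _) fun l => ?_
  rw [Real.sq_sqrt (by positivity)]
  refine (Finset.sum_le_sum fun (p : Fin (N + w)) _ =>
    norm_window_sub_sq_le (w := w) hV hL hδ (l : ℕ) (p : ℕ)).trans ?_
  rw [Finset.sum_add_distrib, ← Finset.mul_sum, sum_norm_window_sq hw, mul_one]
  gcongr
  rw [← Finset.sum_filter, Finset.sum_const, nsmul_eq_mul]
  gcongr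
  norm_cast
  set T : Finset ℤ := {((l : ℕ) : ℤ) - 1, ((l : ℕ) : ℤ), ((l : ℕ) : ℤ) + w - 1, ((l : ℕ) : ℤ) + w}
  calc _ ≤ T.card := Finset.card_le_card_of_injOn (fun p : Fin (N + w) => ((p : ℕ) : ℤ))
        (fun p hp => (Finset.mem_filter.1 hp).2)
        (fun p _ q _ h => Fin.ext (by simpa using h))
    _ ≤ 4 := Finset.card_le_four

end Sphere

section Quantization

/-- The number of circles used at step `m`. -/
abbrev sz (m : ℕ) : ℕ := (m + 1) ^ 2

/-- Multiplication by a function at step `m`. -/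
noncomputable abbrev dg (m : ℕ) (g : Sph → ℂ) := diagF (sz m) (m + 1) g

/-- The isometry used at step `m`. -/
noncomputable abbrev pk (m : ℕ) := packet (sz m) (m + 1)

lemma pk_isometry (m : ℕ) : (pk m)ᴴ * pk m = 1 := packet_isometry _ m.succ_pos

lemma norm_pk_le (m : ℕ) : ‖pk m‖ ≤ 1 := norm_isometry_le (pk_isometry m)

lemma norm_conjTranspose_pk_le (m : ℕ) : ‖(pk m)ᴴ‖ ≤ 1 := by
  rw [l2_opNorm_conjTranspose]
  exact norm_pk_le m

lemma norm_mul_pk_le (m : ℕ) {κ : Type*} [Fintype κ] [DecidableEq κ]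
    (A : Matrix κ (Fin (sz m + (m + 1)) × Mu (sz m)) ℂ) : ‖A * pk m‖ ≤ ‖A‖ :=
  (l2_opNorm_mul _ _).trans (mul_le_of_le_one_right (norm_nonneg _) (norm_pk_le m))

lemma norm_conjTranspose_pk_mul_le (m : ℕ) {κ : Type*} [Fintype κ] [DecidableEq κ]
    (A : Matrix (Fin (sz m + (m + 1)) × Mu (sz m)) κ ℂ) : ‖(pk m)ᴴ * A‖ ≤ ‖A‖ :=
  (l2_opNorm_mul _ _).trans (mul_le_of_le_one_left (norm_nonneg _) (norm_conjTranspose_pk_le m))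

lemma norm_pk_mul_le (m : ℕ) {κ : Type*} [Fintype κ] [DecidableEq κ]
    (A : Matrix (Fin (sz m + 1)) κ ℂ) : ‖pk m * A‖ ≤ ‖A‖ :=
  (l2_opNorm_mul _ _).trans (mul_le_of_le_one_left (norm_nonneg _) (norm_pk_le m))

lemma norm_le_norm_pk_mul (m : ℕ) {κ : Type*} [Fintype κ] [DecidableEq κ]
    (A : Matrix (Fin (sz m + 1)) κ ℂ) : ‖A‖ ≤ ‖pk m * A‖ := by
  have h := norm_conjTranspose_pk_mul_le m (pk m * A)
  rwa [← Matrix.mul_assoc, pk_isometry, Matrix.one_mul] at h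

variable {X : Type*} [TopologicalSpace X]

/-- A matrix approximates a function on the sphere if it intertwines the isometry with
multiplication by the function, and is almost invariant under shifts away from the poles. -/
def Approx (m : ℕ) (g : Sph → ℂ) (A : Matrix (Fin (sz m + 1)) (Fin (sz m + 1)) ℂ) (ε : ℝ) : Prop :=
  ‖dg m g * pk m - pk m * A‖ ≤ ε ∧
    ‖extend (eLast _) A (g north) - extend (eFirst _) A (g south)‖ ≤ ε

/-- A family of functions on the sphere is quantizable if it can be approximated uniformly. -/
def Good (F : C(X × Sph, ℂ)) : Prop :=
  ∀ ε > 0, ∀ᶠ m in atTop, ∀ x, ∃ A, Approx m (fun s => F (x, s)) A ε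

lemma Approx.norm_le {m : ℕ} {g : Sph → ℂ} {A : Matrix (Fin (sz m + 1)) (Fin (sz m + 1)) ℂ}
    {ε C : ℝ} (h : Approx m g A ε) (hC : 0 ≤ C) (hg : ∀ s, ‖g s‖ ≤ C) : ‖A‖ ≤ C + ε := by
  calc ‖A‖ ≤ ‖pk m * A‖ := norm_le_norm_pk_mul m A
    _ = ‖dg m g * pk m - (dg m g * pk m - pk m * A)‖ := by rw [sub_sub_cancel]
    _ ≤ ‖dg m g * pk m‖ + ‖dg m g * pk m - pk m * A‖ := norm_sub_le _ _
    _ ≤ C + ε := add_le_add ((norm_mul_pk_le m _).trans (norm_diagF_le _ _ hC hg)) h.1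

lemma Approx.add {m : ℕ} {g g' : Sph → ℂ} {A A' : Matrix (Fin (sz m + 1)) (Fin (sz m + 1)) ℂ}
    {ε ε' : ℝ} (h : Approx m g A ε) (h' : Approx m g' A' ε') :
    Approx m (fun s => g s + g' s) (A + A') (ε + ε') := by
  constructor
  · have : dg m (fun s => g s + g' s) = dg m g + dg m g' := by
      simp [dg, diagF]
    rw [this, Matrix.add_mul, Matrix.mul_add, add_sub_add_comm]
    exact (norm_add_le _ _).trans (add_le_add h.1 h'.1)
  · rw [extend_add, extend_add, add_sub_add_comm]
    exact (norm_add_le _ _).trans (add_le_add h.2 h'.2)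

lemma Approx.mul {m : ℕ} {g g' : Sph → ℂ} {A A' : Matrix (Fin (sz m + 1)) (Fin (sz m + 1)) ℂ}
    {ε C : ℝ} (h : Approx m g A ε) (h' : Approx m g' A' ε) (hC : 0 ≤ C) (hε : ε ≤ 1)
    (hg : ∀ s, ‖g s‖ ≤ C) (hg' : ∀ s, ‖g' s‖ ≤ C) :
    Approx m (fun s => g s * g' s) (A * A') (2 * (2 * C + 1) * ε) := by
  have hε0 : 0 ≤ ε := (norm_nonneg _).trans h.1
  have hA := h.norm_le hC hg
  have hA' := h'.norm_le hC hg'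
  constructor
  · have e : dg m (fun s => g s * g' s) = dg m g * dg m g' := by
      simp [dg, diagF]
    have e2 : dg m g * dg m g' * pk m - pk m * (A * A') =
        dg m g * (dg m g' * pk m - pk m * A') + (dg m g * pk m - pk m * A) * A' := by
      simp only [Matrix.mul_sub, Matrix.sub_mul, Matrix.mul_assoc]
      abel
    rw [e, e2]
    calc _ ≤ ‖dg m g‖ * ‖dg m g' * pk m - pk m * A'‖ + ‖dg m g * pk m - pk m * A‖ * ‖A'‖ :=
          (norm_add_le _ _).trans (add_le_add (l2_opNorm_mul _ _) (l2_opNorm_mul _ _))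
      _ ≤ C * ε + ε * (C + ε) := by
          gcongr
          · exact norm_diagF_le _ _ hC hg
          · exact h'.1
          · exact h.1
      _ ≤ _ := by nlinarith
  · rw [extend_mul, extend_mul]
    set P := extend (eLast (sz m + 1)) A (g north)
    set P' := extend (eLast (sz m + 1)) A' (g' north)
    set R := extend (eFirst (sz m + 1)) A (g south)
    set R' := extend (eFirst (sz m + 1)) A' (g' south)
    have e2 : P * P' - R * R' = P * (P' - R') + (P - R) * R' := by
      simp only [Matrix.mul_sub, Matrix.sub_mul]
      abel
    have hP : ‖P‖ ≤ C + ε + C := (norm_extend_le _ _ _).trans (add_le_add hA (hg _))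
    have hR : ‖R'‖ ≤ C + ε + C := (norm_extend_le _ _ _).trans (add_le_add hA' (hg' _))
    rw [e2]
    calc _ ≤ ‖P‖ * ‖P' - R'‖ + ‖P - R‖ * ‖R'‖ :=
          (norm_add_le _ _).trans (add_le_add (l2_opNorm_mul _ _) (l2_opNorm_mul _ _))
      _ ≤ (C + ε + C) * ε + ε * (C + ε + C) := by
          gcongr
          · exact h'.2
          · exact h.2
      _ ≤ _ := by nlinarith

lemma Approx.of_close {m : ℕ} {g g' : Sph → ℂ} {A : Matrix (Fin (sz m + 1)) (Fin (sz m + 1)) ℂ}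
    {ε η : ℝ} (h : Approx m g A ε) (hη : 0 ≤ η) (hg : ∀ s, ‖g' s - g s‖ ≤ η) :
    Approx m g' A (ε + 2 * η) := by
  constructor
  · have e : dg m g' * pk m - pk m * A =
        (dg m g * pk m - pk m * A) + dg m (fun s => g' s - g s) * pk m := by
      have : dg m g' = dg m g + dg m (fun s => g' s - g s) := by
        simp [dg, diagF]
      rw [this, Matrix.add_mul]
      abel
    rw [e]
    refine (norm_add_le _ _).trans (add_le_add h.1 ?_)
    refine (norm_mul_pk_le m _).trans ((norm_diagF_le _ _ hη hg).trans ?_)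
    linarith
  · have e : ∀ (e : Fin (sz m + 1) ⊕ Unit ≃ Fin (sz m + 1 + 1)) (y z : ℂ),
        extend e A y = extend e A z + extend e 0 (y - z) := by
      intro e y z
      rw [← extend_add, add_zero, add_sub_cancel]
    rw [e _ (g' north) (g north), e _ (g' south) (g south), add_sub_add_comm]
    refine (norm_add_le _ _).trans (add_le_add h.2 ?_)
    have h1 := norm_extend_le (eLast (sz m + 1)) 0 (g' north - g north)
    have h2 := norm_extend_le (eFirst (sz m + 1)) 0 (g' south - g south)
    rw [norm_zero, zero_add] at h1 h2
    have := norm_sub_le (extend (eLast (sz m + 1)) 0 (g' north - g north))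
      (extend (eFirst (sz m + 1)) 0 (g' south - g south))
    linarith [hg north, hg south]

lemma approx_const (m : ℕ) (z : ℂ) : Approx m (fun _ => z) (z • 1) 0 := by
  constructor
  · have : dg m (fun _ => z) = z • 1 := by
      simp [dg, diagF, smul_one_eq_diagonal]
    simp [this]
  · simp [extend_smul_one]

lemma Approx.mono {m : ℕ} {g : Sph → ℂ} {A : Matrix (Fin (sz m + 1)) (Fin (sz m + 1)) ℂ}
    {ε ε' : ℝ} (h : Approx m g A ε) (hε : ε ≤ ε') : Approx m g A ε' :=
  ⟨h.1.trans hε, h.2.trans hε⟩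

lemma good_of_fst (f : C(X, ℂ)) : Good (f.comp (ContinuousMap.fst : C(X × Sph, X))) :=
  fun _ hε => Eventually.of_forall fun m x => ⟨_, (approx_const m (f x)).mono hε.le⟩

lemma good_of_snd {g : C(Sph, ℂ)} {V : ℕ → ℕ → ℝ} (hV : ∀ N p, 0 ≤ V N p ∧ V N p ≤ 1)
    (hL : ∀ N p q : ℕ, |V N p - V N q| ≤ |(p : ℝ) - q| / N) {δ : ℤ} (hδ : |δ| ≤ 1)
    (h0 : ∀ N, 0 < N → δ ≠ 0 → V N 0 = 0 ∧ V N N = 0 ∧ V N (N + 1) = 0)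
    (hg : ∀ N w q, g (pt N w q) = V N q.1 * ((q.2 : ℂˣ) : ℂ) ^ δ)
    (hn : ∀ N, 0 < N → g north = if δ = 0 then (V N (N + 1) : ℂ) else 0)
    (hs : ∀ N, 0 < N → g south = if δ = 0 then (V N 0 : ℂ) else 0) :
    Good (g.comp (ContinuousMap.snd : C(X × Sph, Sph))) := by
  intro ε hε
  have hlim : Tendsto (fun m : ℕ => √(5 * ((m : ℝ) + 1)⁻¹)) atTop (nhds 0) := by
    have h1 : Tendsto (fun m : ℕ => ((m : ℝ) + 1)⁻¹) atTop (nhds 0) := by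
      simpa using tendsto_one_div_add_atTop_nhds_zero_nat (𝕜 := ℝ)
    have h2 := (Real.continuous_sqrt.tendsto _).comp (h1.const_mul 5)
    rw [mul_zero, Real.sqrt_zero] at h2
    exact h2
  filter_upwards [hlim.eventually (ge_mem_nhds hε)] with m hm x
  have hsz : 0 < sz m := by positivity
  have hm1 : (1 : ℝ) ≤ (m : ℝ) + 1 := by linarith [(Nat.cast_nonneg m : (0 : ℝ) ≤ m)]
  have hinv : ((m : ℝ) + 1)⁻¹ ≤ 1 := inv_le_one_of_one_le₀ hm1
  have hinv0 : 0 ≤ ((m : ℝ) + 1)⁻¹ := by positivity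
  refine ⟨shift (sz m + 1) (fun l => V (sz m) l) δ, ?_, ?_⟩
  · refine (norm_diagF_mul_packet_sub_le m.succ_pos (hV _) (hL _) hδ
      (fun h => ⟨(h0 _ hsz h).1, (h0 _ hsz h).2.1⟩) (hg _ _)).trans (le_trans ?_ hm)
    apply Real.sqrt_le_sqrt
    have : (((m + 1 : ℕ) : ℝ) / (sz m : ℕ)) = ((m : ℝ) + 1)⁻¹ := by
      simp only [sz]
      push_cast
      field_simp
    rw [this]
    push_cast
    nlinarith
  · have e1 := extend_eLast_shift (n := sz m) (V := fun l => (V (sz m) l : ℂ)) hδ (fun h => by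
      simpa using (h0 _ hsz h).2)
    have e2 := extend_eFirst_shift (n := sz m) (V := fun l => (V (sz m) l : ℂ)) hδ (fun h => by
      simpa using (h0 _ hsz h).1)
    simp only [ContinuousMap.comp_apply, ContinuousMap.snd_apply]
    rw [hn _ hsz, hs _ hsz, e1, e2]
    have e3 : shift (sz m + 2) (fun l => (V (sz m) l : ℂ)) δ -
        shift (sz m + 2) (fun l => (V (sz m) (l - 1) : ℂ)) δ =
        shift (sz m + 2) (fun l => ((V (sz m) l - V (sz m) (l - 1) : ℝ) : ℂ)) δ := by
      ext k l
      simp only [shift, Matrix.sub_apply, of_apply]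
      split_ifs <;> simp
    rw [e3]
    refine norm_shift_le hε.le fun l => ?_
    rw [Complex.norm_real, Real.norm_eq_abs]
    refine (hL _ _ _).trans (le_trans ?_ hm)
    have h1 : |(l : ℝ) - ((l - 1 : ℕ) : ℝ)| ≤ 1 := by
      rcases l with _ | l <;> simp
    calc _ ≤ 1 / ((sz m : ℕ) : ℝ) := by gcongr
      _ = (((m : ℝ) + 1)⁻¹) ^ 2 := by simp [sz]
      _ ≤ √(5 * ((m : ℝ) + 1)⁻¹) := by
          apply Real.le_sqrt_of_sq_le
          have : (((m : ℝ) + 1)⁻¹) ^ 2 ≤ ((m : ℝ) + 1)⁻¹ := by nlinarith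
          nlinarith [sq_nonneg ((m : ℝ) + 1)⁻¹]

/-- The height function. -/
def height : C(Sph, ℂ) := ⟨fun s => (s.1.1 : ℂ), by fun_prop⟩

/-- The horizontal coordinate. -/
def horiz : C(Sph, ℂ) := ⟨fun s => s.1.2, by fun_prop⟩

lemma good_height : Good (height.comp (ContinuousMap.snd : C(X × Sph, Sph))) :=
  good_of_snd (V := rad) (δ := 0) (fun N p => ⟨rad_nonneg N p, rad_le_one N p⟩)
    abs_rad_sub_rad_le (by simp) (by simp) (by simp [height, pt])
    (fun N hN => by simp [height, north, rad_eq_one hN]) (by simp [height, south, rad_zero])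

lemma prof_ends {N : ℕ} (hN : 0 < N) : prof N 0 = 0 ∧ prof N N = 0 ∧ prof N (N + 1) = 0 := by
  simp [prof, rad_zero, rad_eq_one hN]

lemma good_horiz : Good (horiz.comp (ContinuousMap.snd : C(X × Sph, Sph))) :=
  good_of_snd (V := prof) (δ := 1) (fun N p => ⟨prof_nonneg N p, prof_le_one N p⟩)
    abs_prof_sub_prof_le (by simp) (fun N hN _ => prof_ends hN) (by simp [horiz, pt])
    (by simp [horiz, north]) (by simp [horiz, south])

lemma good_star_horiz : Good ((star horiz).comp (ContinuousMap.snd : C(X × Sph, Sph))) :=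
  good_of_snd (V := prof) (δ := -1) (fun N p => ⟨prof_nonneg N p, prof_le_one N p⟩)
    abs_prof_sub_prof_le (by simp) (fun N hN _ => prof_ends hN)
    (fun N w q => by simp [horiz, pt, Complex.inv_eq_conj (norm_Mu q.2)])
    (by simp [horiz, north]) (by simp [horiz, south])

end Quantization

section StoneWeierstrass

variable {X : Type*} [MetricSpace X] [CompactSpace X]

lemma Good.add {F G : C(X × Sph, ℂ)} (hF : Good F) (hG : Good G) : Good (F + G) := by
  intro ε hε
  filter_upwards [hF (ε / 2) (half_pos hε), hG (ε / 2) (half_pos hε)] with m h1 h2 x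
  obtain ⟨A, hA⟩ := h1 x
  obtain ⟨B, hB⟩ := h2 x
  exact ⟨A + B, (hA.add hB).mono (add_halves ε).le⟩

lemma Good.mul {F G : C(X × Sph, ℂ)} (hF : Good F) (hG : Good G) : Good (F * G) := by
  intro ε hε
  set C := ‖F‖ + ‖G‖
  have hC : 0 ≤ C := by positivity
  set η := min 1 (ε / (2 * (2 * C + 1)))
  have hη : 0 < η := lt_min one_pos (by positivity)
  filter_upwards [hF η hη, hG η hη] with m h1 h2 x
  obtain ⟨A, hA⟩ := h1 x
  obtain ⟨B, hB⟩ := h2 x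
  refine ⟨A * B, (hA.mul hB hC (min_le_left _ _) ?_ ?_).mono ?_⟩
  · exact fun s => (F.norm_coe_le_norm _).trans (le_add_of_nonneg_right (norm_nonneg _))
  · exact fun s => (G.norm_coe_le_norm _).trans (le_add_of_nonneg_left (norm_nonneg _))
  · have := min_le_right 1 (ε / (2 * (2 * C + 1)))
    rwa [le_div_iff₀' (by positivity)] at this

/-- The star algebra of quantizable families with quantizable adjoint. -/
def goodAlgebra (X : Type*) [MetricSpace X] [CompactSpace X] : StarSubalgebra ℂ C(X × Sph, ℂ) where
  carrier := {F | Good F ∧ Good (star F)}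
  add_mem' h h' := ⟨h.1.add h'.1, by rw [star_add]; exact h.2.add h'.2⟩
  mul_mem' h h' := ⟨h.1.mul h'.1, by rw [star_mul]; exact h'.2.mul h.2⟩
  algebraMap_mem' z := by
    have h : ∀ z : ℂ, Good (algebraMap ℂ C(X × Sph, ℂ) z) := fun z => good_of_fst (.const X z)
    exact ⟨h z, by rw [← algebraMap_star_comm]; exact h _⟩
  star_mem' h := ⟨h.2, by rw [star_star]; exact h.1⟩

lemma goodAlgebra_separatesPoints : (goodAlgebra X).SeparatesPoints := by
  have hmem : ∀ F ∈ goodAlgebra X, (F : X × Sph → ℂ) ∈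
      (fun f : C(X × Sph, ℂ) => (f : X × Sph → ℂ)) '' (goodAlgebra X).toSubalgebra :=
    fun F hF => ⟨F, hF, rfl⟩
  rintro ⟨x, s⟩ ⟨y, t⟩ hne
  by_cases hxy : x = y
  · have hst : s ≠ t := fun h => hne (by rw [hxy, h])
    by_cases h1 : s.1.1 = t.1.1
    · refine ⟨_, hmem (horiz.comp ContinuousMap.snd) ⟨good_horiz, good_star_horiz⟩, ?_⟩
      intro h2
      exact hst (Subtype.ext (Prod.ext h1 h2))
    · refine ⟨_, hmem (height.comp ContinuousMap.snd) ⟨good_height, ?_⟩, ?_⟩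
      · have : star (height.comp (ContinuousMap.snd : C(X × Sph, Sph))) =
            height.comp ContinuousMap.snd := by
          ext z
          simp [height]
        rw [this]
        exact good_height
      · intro h2
        exact h1 (Complex.ofReal_injective h2)
  · let f : C(X, ℂ) := ⟨fun z => (dist z y : ℂ), by fun_prop⟩
    refine ⟨_, hmem (f.comp ContinuousMap.fst) ⟨good_of_fst f, good_of_fst (star f)⟩, ?_⟩
    simp [f, hxy]

lemma good_all (F : C(X × Sph, ℂ)) : Good F := by
  have htop := ContinuousMap.starSubalgebra_topologicalClosure_eq_top_of_separatesPoints
    (goodAlgebra X) goodAlgebra_separatesPoints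
  have hF : F ∈ closure (goodAlgebra X : Set C(X × Sph, ℂ)) := by
    rw [← StarSubalgebra.topologicalClosure_coe, htop]
    exact Set.mem_univ _
  intro ε hε
  obtain ⟨G, hG, hFG⟩ := Metric.mem_closure_iff.1 hF (ε / 4) (by positivity)
  filter_upwards [hG.1 (ε / 2) (half_pos hε)] with m hm x
  obtain ⟨A, hA⟩ := hm x
  refine ⟨A, (hA.of_close (η := ε / 4) (by positivity) fun s => ?_).mono (by linarith)⟩
  rw [← dist_eq_norm]
  exact (ContinuousMap.dist_apply_le_dist _).trans hFG.le

/-- The quantization of a function on the sphere. -/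
noncomputable def quant (m : ℕ) (g : Sph → ℂ) : Matrix (Fin (sz m + 1)) (Fin (sz m + 1)) ℂ :=
  (pk m)ᴴ * dg m g * pk m

lemma Approx.approx_quant {m : ℕ} {g : Sph → ℂ} {A : Matrix (Fin (sz m + 1)) (Fin (sz m + 1)) ℂ}
    {ε : ℝ} (h : Approx m g A ε) : Approx m g (quant m g) (3 * ε) := by
  have hQ : ‖quant m g - A‖ ≤ ε := by
    have e : quant m g - A = (pk m)ᴴ * (dg m g * pk m - pk m * A) := by
      rw [Matrix.mul_sub, ← Matrix.mul_assoc, ← Matrix.mul_assoc, pk_isometry, Matrix.one_mul]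
      rfl
    rw [e]
    exact (norm_conjTranspose_pk_mul_le m _).trans h.1
  have hε0 : 0 ≤ ε := (norm_nonneg _).trans h.1
  constructor
  · have e : dg m g * pk m - pk m * quant m g =
        (dg m g * pk m - pk m * A) - pk m * (quant m g - A) := by
      rw [Matrix.mul_sub]
      abel
    rw [e]
    have := norm_sub_le (dg m g * pk m - pk m * A) (pk m * (quant m g - A))
    linarith [h.1, (norm_pk_mul_le m (quant m g - A)).trans hQ]
  · have e : ∀ (e : Fin (sz m + 1) ⊕ Unit ≃ Fin (sz m + 1 + 1)) (z : ℂ),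
        extend e (quant m g) z =
          extend e A z + extend e (quant m g - A) 0 := by
      intro e z
      rw [← extend_add, add_zero, add_sub_cancel]
    rw [e, e, add_sub_add_comm]
    have h1 := norm_extend_le (eLast (sz m + 1)) (quant m g - A) 0
    have h2 := norm_extend_le (eFirst (sz m + 1)) (quant m g - A) 0
    rw [norm_zero, add_zero] at h1 h2
    have h3 := norm_sub_le (extend (eLast (sz m + 1)) (quant m g - A) 0)
      (extend (eFirst (sz m + 1)) (quant m g - A) 0)
    refine (norm_add_le _ _).trans ?_
    linarith [h.2]

lemma eventually_approx_quant (F : C(X × Sph, ℂ)) {ε : ℝ} (hε : 0 < ε) :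
    ∀ᶠ m in atTop, ∀ x, Approx m (fun s => F (x, s)) (quant m fun s => F (x, s)) ε := by
  filter_upwards [good_all F (ε / 3) (by positivity)] with m hm x
  obtain ⟨A, hA⟩ := hm x
  exact hA.approx_quant.mono (by linarith)

end StoneWeierstrass

section DirectSum

variable {ι α β : Type*} [Fintype ι] [DecidableEq ι] [Fintype α] [DecidableEq α]
  [Fintype β] [DecidableEq β]

lemma eNorm_sq_sum (e : α ⊕ β ≃ ι) (ξ : ι → ℂ) :
    eNorm ξ ^ 2 = eNorm (ξ ∘ e ∘ .inl) ^ 2 + eNorm (ξ ∘ e ∘ .inr) ^ 2 := by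
  simp only [eNorm_sq, ← e.sum_comp, Fintype.sum_sum_type, Function.comp_apply]

lemma BoundedBelow.sum (e : α ⊕ β ≃ ι) {M : Matrix ι ι ℂ} {r : ℝ} (hr : 0 ≤ r)
    (h1 : ∀ a b, M (e (.inl a)) (e (.inr b)) = 0) (h2 : ∀ a b, M (e (.inr a)) (e (.inl b)) = 0)
    (hα : BoundedBelow (M.submatrix (e ∘ .inl) (e ∘ .inl)) r)
    (hβ : BoundedBelow (M.submatrix (e ∘ .inr) (e ∘ .inr)) r) : BoundedBelow M r := by
  intro ξ
  have e1 : (M *ᵥ ξ) ∘ e ∘ .inl = M.submatrix (e ∘ .inl) (e ∘ .inl) *ᵥ (ξ ∘ e ∘ .inl) := by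
    ext a
    simp [mulVec, dotProduct, ← e.sum_comp, h1]
  have e2 : (M *ᵥ ξ) ∘ e ∘ .inr = M.submatrix (e ∘ .inr) (e ∘ .inr) *ᵥ (ξ ∘ e ∘ .inr) := by
    ext a
    simp [mulVec, dotProduct, ← e.sum_comp, h2]
  refine le_of_sq_le_sq ?_ (eNorm_nonneg _)
  rw [mul_pow, eNorm_sq_sum e ξ, eNorm_sq_sum e (M *ᵥ ξ), e1, e2, mul_add, ← mul_pow, ← mul_pow]
  have := mul_nonneg hr (eNorm_nonneg (ξ ∘ e ∘ .inl))
  have := mul_nonneg hr (eNorm_nonneg (ξ ∘ e ∘ .inr))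
  gcongr
  · exact hα _
  · exact hβ _

lemma Graded.sum (e : α ⊕ β ≃ ι) {M : Matrix ι ι ℂ} {wt : ι → ZMod 4}
    (h1 : ∀ a b, M (e (.inl a)) (e (.inr b)) = 0) (h2 : ∀ a b, M (e (.inr a)) (e (.inl b)) = 0)
    (hα : Graded (M.submatrix (e ∘ .inl) (e ∘ .inl)) (wt ∘ e ∘ .inl))
    (hβ : Graded (M.submatrix (e ∘ .inr) (e ∘ .inr)) (wt ∘ e ∘ .inr)) : Graded M wt := by
  intro a b hab
  obtain ⟨a, rfl⟩ := e.surjective a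
  obtain ⟨b, rfl⟩ := e.surjective b
  rcases a with a | a <;> rcases b with b | b
  · exact hα a b hab
  · exact h1 a b
  · exact h2 a b
  · exact hβ a b hab

lemma isHermitian_sum (e : α ⊕ β ≃ ι) {M : Matrix ι ι ℂ}
    (h1 : ∀ a b, M (e (.inl a)) (e (.inr b)) = 0) (h2 : ∀ a b, M (e (.inr a)) (e (.inl b)) = 0)
    (hα : (M.submatrix (e ∘ .inl) (e ∘ .inl)).IsHermitian)
    (hβ : (M.submatrix (e ∘ .inr) (e ∘ .inr)).IsHermitian) : M.IsHermitian := by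
  ext a b
  obtain ⟨a, rfl⟩ := e.surjective a
  obtain ⟨b, rfl⟩ := e.surjective b
  rcases a with a | a <;> rcases b with b | b
  · exact hα.apply a b
  · simp [h1, h2]
  · simp [h1, h2]
  · exact hβ.apply a b

/-- Adding one copy of the index set `ι` to `ι × α`. -/
def prodExtend (ι : Type*) (e : α ⊕ Unit ≃ β) : (ι × α) ⊕ ι ≃ ι × β :=
  ((Equiv.sumCongr (Equiv.refl _) (Equiv.prodPUnit ι).symm).trans
    (Equiv.prodSumDistrib ι α Unit).symm).trans (Equiv.prodCongr (Equiv.refl ι) e)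

@[simp] lemma prodExtend_inl (e : α ⊕ Unit ≃ β) (a : ι) (i : α) :
    prodExtend ι e (.inl (a, i)) = (a, e (.inl i)) := rfl

@[simp] lemma prodExtend_inr (e : α ⊕ Unit ≃ β) (a : ι) :
    prodExtend ι e (.inr a) = (a, e (.inr ())) := rfl

/-- Blockwise direct sum of a block matrix with another matrix. -/
def blkExtend (e : α ⊕ Unit ≃ β) (D : ι → ι → Matrix α α ℂ) (K : Matrix ι ι ℂ) :
    Matrix (ι × β) (ι × β) ℂ :=
  blk fun a b => extend e (D a b) (K a b)

variable (e : α ⊕ Unit ≃ β) (D : ι → ι → Matrix α α ℂ) (K : Matrix ι ι ℂ)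

lemma blkExtend_inl_inr (p : ι × α) (q : ι) :
    blkExtend e D K (prodExtend ι e (.inl p)) (prodExtend ι e (.inr q)) = 0 := by
  simp [blkExtend, blk, extend, prodExtend]

lemma blkExtend_inr_inl (p : ι) (q : ι × α) :
    blkExtend e D K (prodExtend ι e (.inr p)) (prodExtend ι e (.inl q)) = 0 := by
  simp [blkExtend, blk, extend, prodExtend]

lemma blkExtend_submatrix_inl :
    (blkExtend e D K).submatrix (prodExtend ι e ∘ .inl) (prodExtend ι e ∘ .inl) = blk D := by
  ext p q
  simp [blkExtend, blk, extend, prodExtend]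

lemma blkExtend_submatrix_inr :
    (blkExtend e D K).submatrix (prodExtend ι e ∘ .inr) (prodExtend ι e ∘ .inr) = K := by
  ext p q
  simp [blkExtend, blk, extend, prodExtend]

variable {D K} {r : ℝ}

lemma BoundedBelow.blkExtend (hr : 0 ≤ r) (hD : BoundedBelow (blk D) r) (hK : BoundedBelow K r) :
    BoundedBelow (blkExtend e D K) r :=
  .sum (prodExtend ι e) hr (blkExtend_inl_inr e D K) (blkExtend_inr_inl e D K)
    (by rwa [blkExtend_submatrix_inl]) (by rwa [blkExtend_submatrix_inr])

lemma isHermitian_blkExtend (hD : (blk D).IsHermitian) (hK : K.IsHermitian) :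
    (blkExtend e D K).IsHermitian :=
  isHermitian_sum (prodExtend ι e) (blkExtend_inl_inr e D K) (blkExtend_inr_inl e D K)
    (by rwa [blkExtend_submatrix_inl]) (by rwa [blkExtend_submatrix_inr])

lemma Graded.blkExtend {wt : ι × β → ZMod 4}
    (hD : Graded (blk D) (wt ∘ prodExtend ι e ∘ .inl))
    (hK : Graded K (wt ∘ prodExtend ι e ∘ .inr)) : Graded (blkExtend e D K) wt :=
  .sum (prodExtend ι e) (blkExtend_inl_inr e D K) (blkExtend_inr_inl e D K)
    (by rwa [blkExtend_submatrix_inl]) (by rwa [blkExtend_submatrix_inr])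

lemma posg_blkExtend {wt : ι × β → ZMod 4} (hD : (blk D).IsHermitian) (hK : K.IsHermitian)
    (hr : 0 < r) (hDb : BoundedBelow (blk D) r) (hKb : BoundedBelow K r)
    (hDg : Graded (blk D) (wt ∘ prodExtend ι e ∘ .inl))
    (hKg : Graded K (wt ∘ prodExtend ι e ∘ .inr)) :
    posg (blkExtend e D K) wt = posg (blk D) (wt ∘ prodExtend ι e ∘ .inl) +
      posg K (wt ∘ prodExtend ι e ∘ .inr) := by
  rw [posg_sum (prodExtend ι e) (isHermitian_blkExtend e hD hK) (.blkExtend e hDg hKg)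
    (blkExtend_inl_inr e D K) hr (hDb.blkExtend e hr.le hKb), blkExtend_submatrix_inl,
    blkExtend_submatrix_inr]

end DirectSum

section Shift

variable {ι : Type*} [Fintype ι] [DecidableEq ι]

/-- The weights of the tensor product with the space of waves on a circle of weight `τ`. -/
def waveWt (wt : ι → ZMod 4) (τ : ZMod 4) {n : ℕ} (p : ι × Fin n) : ZMod 4 :=
  wt p.1 - (p.2 : ℕ) * τ

lemma waveWt_eLast_inl (wt : ι → ZMod 4) (τ : ZMod 4) (n : ℕ) :
    waveWt wt τ ∘ prodExtend ι (eLast n) ∘ .inl = waveWt wt τ := by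
  ext p
  simp [waveWt, prodExtend, eLast]

lemma waveWt_eLast_inr (wt : ι → ZMod 4) (τ : ZMod 4) (n : ℕ) :
    waveWt wt τ ∘ prodExtend ι (eLast n) ∘ .inr = fun a => wt a + -(n * τ) := by
  ext p
  simp [waveWt, prodExtend, eLast, sub_eq_add_neg]

lemma waveWt_eFirst_inl (wt : ι → ZMod 4) (τ : ZMod 4) (n : ℕ) :
    waveWt wt τ ∘ prodExtend ι (eFirst n) ∘ .inl = fun p => waveWt wt τ p + -τ := by
  ext p
  simp [waveWt, prodExtend, eFirst]
  ring

lemma waveWt_eFirst_inr (wt : ι → ZMod 4) (τ : ZMod 4) (n : ℕ) :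
    waveWt wt τ ∘ prodExtend ι (eFirst n) ∘ .inr = wt := by
  ext p
  simp [waveWt, prodExtend, eFirst]

lemma Graded.add_right {M : Matrix ι ι ℂ} {wt : ι → ZMod 4} (h : Graded M wt) (s : ZMod 4) :
    Graded M fun a => wt a + s :=
  fun a b hab => h a b fun h' => hab (by simp only [h'])

lemma posg_add_eq_of_close {n : ℕ} {D : ι → ι → Matrix (Fin n) (Fin n) ℂ} {K L : Matrix ι ι ℂ}
    {wt : ι → ZMod 4} {τ : ZMod 4} {r : ℝ} (hr : 0 < r) (hD : (blk D).IsHermitian)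
    (hDb : BoundedBelow (blk D) r) (hDg : Graded (blk D) (waveWt wt τ)) (hK : K.IsHermitian)
    (hKb : BoundedBelow K r) (hKg : Graded K wt) (hL : L.IsHermitian)
    (hLb : BoundedBelow L r) (hLg : Graded L wt)
    (h : ‖blkExtend (eLast n) D K - blkExtend (eFirst n) D L‖ < r) :
    posg (blk D) (waveWt wt τ) + i4 (-(n * τ)) * posg K wt =
      i4 (-τ) * posg (blk D) (waveWt wt τ) + posg L wt := by
  have hDg' : Graded (blk D) (waveWt wt τ ∘ prodExtend ι (eFirst n) ∘ .inl) := by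
    rw [waveWt_eFirst_inl]
    exact hDg.add_right _
  have hLg' : Graded L (waveWt wt τ ∘ prodExtend ι (eFirst n) ∘ .inr) := by
    rwa [waveWt_eFirst_inr]
  have key := posg_eq_of_close (isHermitian_blkExtend (eFirst n) hD hL)
    (.blkExtend (eFirst n) hDg' hLg') (hDb.blkExtend (eFirst n) hr.le hLb) h
  rw [posg_blkExtend _ hD hL hr hDb hLb hDg' hLg', posg_blkExtend _ hD hK hr hDb hKb
    (by rwa [waveWt_eLast_inl]) (by rw [waveWt_eLast_inr]; exact hKg.add_right _),
    waveWt_eLast_inl, waveWt_eLast_inr, waveWt_eFirst_inl, waveWt_eFirst_inr, posg_shift,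
    posg_shift] at key
  exact key

end Shift

section MatrixQuantization

variable {ι : Type*} [Fintype ι] [DecidableEq ι]

lemma quant_apply (m : ℕ) (g : Sph → ℂ) (k l : Fin (sz m + 1)) :
    quant m g k l = ∑ q, star (pk m q k) * g (pt (sz m) (m + 1) q) * pk m q l := by
  simp [quant, mul_apply, dg, diagF, diagonal_apply]

lemma star_quant (m : ℕ) (g : Sph → ℂ) (k l : Fin (sz m + 1)) :
    star (quant m g k l) = quant m (fun s => star (g s)) l k := by
  simp only [quant_apply, star_sum, star_mul', star_star]
  exact Finset.sum_congr rfl fun q _ => by ring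

lemma quant_const_mul (m : ℕ) (z : ℂ) (g : Sph → ℂ) (k l : Fin (sz m + 1)) :
    quant m (fun s => z * g s) k l = z * quant m g k l := by
  simp only [quant_apply, Finset.mul_sum]
  exact Finset.sum_congr rfl fun q _ => by ring

/-- The root of unity `i ^ c`. -/
noncomputable def rootMu (N : ℕ) (c : ZMod 4) : Mu N :=
  rootsOfUnity.mkOfPowEq (χ c) (by rw [pow_mul, χ_pow_four, one_pow])

@[simp] lemma coe_rootMu (N : ℕ) (c : ZMod 4) : ((rootMu N c : ℂˣ) : ℂ) = χ c :=
  rootsOfUnity.coe_mkOfPowEq _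

lemma pt_rootMu_mul (N w : ℕ) (c : ZMod 4) (p : Fin (N + w)) (ζ : Mu N) :
    pt N w (p, rootMu N c * ζ) = rot c (pt N w (p, ζ)) := by
  ext
  · rfl
  · simp only [pt, rot, Subgroup.coe_mul, Units.val_mul, coe_rootMu]
    ring

lemma χ_natCast_mul (n : ℕ) (c : ZMod 4) : χ (n * c) = χ c ^ n := by
  induction n with
  | zero => simp [χ_zero]
  | succ n ih => rw [Nat.cast_succ, add_one_mul, χ_add, ih, pow_succ]

lemma packet_rootMu_mul (N w : ℕ) (c : ZMod 4) (p : Fin (N + w)) (ζ : Mu N) (l : Fin (N + 1)) :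
    packet N w (p, rootMu N c * ζ) l = χ ((l : ℕ) * c) * packet N w (p, ζ) l := by
  simp only [packet, waveMat, of_apply, Subgroup.coe_mul, Units.val_mul, coe_rootMu, add_zero,
    zpow_natCast, mul_pow, χ_natCast_mul]
  ring

lemma quant_rot (m : ℕ) (c : ZMod 4) (g : Sph → ℂ) (k l : Fin (sz m + 1)) :
    quant m (fun s => g (rot c s)) k l = χ ((k : ℕ) * c - (l : ℕ) * c) * quant m g k l := by
  have h : ∀ F : Fin (sz m + (m + 1)) × Mu (sz m) → ℂ,
      ∑ q, F q = ∑ q : Fin (sz m + (m + 1)) × Mu (sz m), F (q.1, rootMu _ c * q.2) := fun F =>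
    ((Equiv.prodCongr (Equiv.refl _) (Equiv.mulLeft (rootMu (sz m) c))).sum_comp F).symm
  rw [quant_apply, quant_apply, h fun q => star (pk m q k) * g (pt (sz m) (m + 1) q) * pk m q l,
    Finset.mul_sum]
  refine Finset.sum_congr rfl fun q _ => ?_
  have hk : ∀ l, pk m (q.1, rootMu _ c * q.2) l = χ ((l : ℕ) * c) * pk m q l :=
    packet_rootMu_mul _ _ c q.1 q.2
  rw [pt_rootMu_mul, hk, hk, star_mul', star_χ, sub_eq_add_neg, χ_add]
  have h1 := χ_neg_mul ((k : ℕ) * c)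
  have h2 := χ_neg_mul ((l : ℕ) * c)
  linear_combination (exp := 1) -(star (pk m q k) * g (rot c (pt (sz m) (m + 1) q)) * pk m q l) *
    (h1 * (χ (-((l : ℕ) * c)) * χ ((l : ℕ) * c)) + h2)

/-- The quantization of a matrix-valued function on the sphere. -/
noncomputable def mquant (m : ℕ) (h : Sph → Matrix ι ι ℂ) :
    Matrix (ι × Fin (sz m + 1)) (ι × Fin (sz m + 1)) ℂ :=
  blk fun a b => quant m fun s => h s a b

lemma isHermitian_mquant (m : ℕ) {h : Sph → Matrix ι ι ℂ} (hh : ∀ s, (h s).IsHermitian) :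
    (mquant m h).IsHermitian := by
  ext p q
  simp only [conjTranspose_apply, mquant, blk, of_apply, star_quant]
  congr
  ext s
  exact (hh s).apply _ _

lemma boundedBelow_blk_dg (m : ℕ) {h : Sph → Matrix ι ι ℂ} {c : ℝ} (hc : 0 ≤ c)
    (hb : ∀ s, BoundedBelow (h s) c) : BoundedBelow (blk fun a b => dg m fun s => h s a b) c := by
  intro ξ
  have hsq : ∀ η : ι × (Fin (sz m + (m + 1)) × Mu (sz m)) → ℂ,
      eNorm η ^ 2 = ∑ q, eNorm (fun a => η (a, q)) ^ 2 := by
    intro η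
    simp only [eNorm_sq, Fintype.sum_prod_type_right]
  refine le_of_sq_le_sq ?_ (eNorm_nonneg _)
  rw [mul_pow, hsq, hsq, Finset.mul_sum]
  refine Finset.sum_le_sum fun q _ => ?_
  rw [← mul_pow]
  have e : (fun a => ((blk fun a b => dg m fun s => h s a b) *ᵥ ξ) (a, q)) =
      h (pt (sz m) (m + 1) q) *ᵥ fun a => ξ (a, q) := by
    ext a
    simp [mulVec, dotProduct, blk, dg, diagF, Fintype.sum_prod_type_right (α₂ := _ × _),
      diagonal_apply]
  rw [e]
  have := mul_nonneg hc (eNorm_nonneg fun a => ξ (a, q))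
  gcongr
  exact hb _ _

lemma blk_mul_blk {α β γ : Type*} [Fintype β] (D : ι → ι → Matrix α β ℂ)
    (E : ι → ι → Matrix β γ ℂ) : blk D * blk E = blk fun a b => ∑ c, D a c * E c b := by
  ext p q
  simp [blk, mul_apply, Fintype.sum_prod_type, Matrix.sum_apply]

/-- The direct sum of copies of a matrix. -/
def blkDiag (ι : Type*) [DecidableEq ι] {α β : Type*} (A : Matrix α β ℂ) :
    Matrix (ι × α) (ι × β) ℂ :=
  blk fun a b => if a = b then A else 0

lemma blk_mul_blkDiag {α β γ : Type*} [Fintype β] (D : ι → ι → Matrix α β ℂ)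
    (A : Matrix β γ ℂ) :
    blk D * blkDiag ι A = blk fun a b => D a b * A := by
  rw [blkDiag, blk_mul_blk]
  congr
  ext1 a
  ext1 b
  rw [Finset.sum_eq_single b (fun c _ hc => by rw [if_neg hc, Matrix.mul_zero]) (by simp),
    if_pos rfl]

lemma blkDiag_mul_blk {α β γ : Type*} [Fintype β] (A : Matrix α β ℂ)
    (D : ι → ι → Matrix β γ ℂ) :
    blkDiag ι A * blk D = blk fun a b => A * D a b := by
  rw [blkDiag, blk_mul_blk]
  congr
  ext1 a
  ext1 b
  rw [Finset.sum_eq_single a (fun c _ hc => by rw [if_neg hc.symm, Matrix.zero_mul]) (by simp),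
    if_pos rfl]

lemma blk_sub_blk {α β : Type*} (D E : ι → ι → Matrix α β ℂ) :
    blk D - blk E = blk fun a b => D a b - E a b := by
  ext p q
  simp [blk]

/-- The direct sum of copies of the isometry used at step `m`. -/
noncomputable abbrev mpk (ι : Type*) [DecidableEq ι] (m : ℕ) := blkDiag ι (pk m)

lemma mpk_isometry (m : ℕ) : (mpk ι m)ᴴ * mpk ι m = 1 := by
  have h : (mpk ι m)ᴴ = blkDiag ι (pk m)ᴴ := by
    ext p q
    by_cases h : p.1 = q.1 <;> simp [blkDiag, blk, h, eq_comm]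
  rw [h, mpk, blkDiag.eq_def ι (pk m), blkDiag_mul_blk]
  ext p q
  by_cases h : p.1 = q.1
  · simp [blk, h, pk_isometry, one_apply, Prod.ext_iff]
  · simp [blk, h, one_apply, Prod.ext_iff]

lemma boundedBelow_mquant {m : ℕ} {h : Sph → Matrix ι ι ℂ} {c ε : ℝ} (hc : 0 ≤ c)
    (hb : ∀ s, BoundedBelow (h s) c)
    (hε : ‖blk fun a b => (dg m fun s => h s a b) * pk m - pk m * quant m fun s => h s a b‖ ≤ ε) :
    BoundedBelow (mquant m h) (c - ε) := by
  intro ξ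
  set J := mpk ι m
  set T := blk fun a b => dg m fun s => h s a b
  have hJ : ‖J‖ ≤ 1 := norm_isometry_le (mpk_isometry m)
  have hJ' : ‖Jᴴ‖ ≤ 1 := by rwa [l2_opNorm_conjTranspose]
  have e : (blk fun a b => (dg m fun s => h s a b) * pk m - pk m * quant m fun s => h s a b) =
      T * J - J * mquant m h := by
    simp only [T, J, mpk, mquant, blk_mul_blkDiag, blkDiag_mul_blk, blk_sub_blk]
  rw [e] at hε
  have h1 : eNorm ξ ≤ eNorm (J *ᵥ ξ) := by
    have h2 := eNorm_mulVec_le Jᴴ (J *ᵥ ξ)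
    rw [mulVec_mulVec, mpk_isometry, one_mulVec] at h2
    exact h2.trans (mul_le_of_le_one_left (eNorm_nonneg _) hJ')
  have h2 := boundedBelow_blk_dg m hc hb (J *ᵥ ξ)
  have h3 : T *ᵥ (J *ᵥ ξ) = (T * J - J * mquant m h) *ᵥ ξ + J *ᵥ (mquant m h *ᵥ ξ) := by
    rw [sub_mulVec, mulVec_mulVec, mulVec_mulVec, sub_add_cancel]
  have h4 := eNorm_add_le ((T * J - J * mquant m h) *ᵥ ξ) (J *ᵥ (mquant m h *ᵥ ξ))
  rw [← h3] at h4
  have h5 := (eNorm_mulVec_le J (mquant m h *ᵥ ξ)).trans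
    (mul_le_of_le_one_left (eNorm_nonneg _) hJ)
  have h6 := (eNorm_mulVec_le (T * J - J * mquant m h) ξ).trans
    (mul_le_mul_of_nonneg_right hε (eNorm_nonneg ξ))
  have h7 := mul_le_mul_of_nonneg_left h1 hc
  have h8 : c * eNorm (J *ᵥ ξ) ≤ eNorm (T *ᵥ (J *ᵥ ξ)) := h2
  rw [sub_mul]
  linarith

lemma eventually_mquant {X : Type*} [MetricSpace X] [CompactSpace X]
    {h : X → Sph → Matrix ι ι ℂ} (hh : Continuous fun p : X × Sph => h p.1 p.2) {ε : ℝ}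
    (hε : 0 < ε) : ∀ᶠ m in atTop, ∀ x,
      ‖blk fun a b => (dg m fun s => h x s a b) * pk m - pk m * quant m fun s => h x s a b‖ ≤ ε ∧
      ‖blkExtend (eLast _) (fun a b => quant m fun s => h x s a b) (h x north) -
        blkExtend (eFirst _) (fun a b => quant m fun s => h x s a b) (h x south)‖ ≤ ε := by
  set k : ℝ := Fintype.card ι * Fintype.card ι + 1
  have hk : 0 < k := by positivity
  have hev : ∀ a b, ∀ᶠ m in atTop, ∀ x,
      Approx m (fun s => h x s a b) (quant m fun s => h x s a b) (ε / k) := fun a b =>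
    eventually_approx_quant ⟨fun p : X × Sph => h p.1 p.2 a b, hh.matrix_elem a b⟩ (by positivity)
  have hsum : ∀ F : ι → ι → ℝ, (∀ a b, F a b ≤ ε / k) → ∑ a, ∑ b, F a b ≤ ε := by
    intro F hF
    calc ∑ a, ∑ b, F a b ≤ ∑ _a : ι, ∑ _b : ι, ε / k :=
          Finset.sum_le_sum fun a _ => Finset.sum_le_sum fun b _ => hF a b
      _ = (k - 1) * (ε / k) := by
          simp [k]
          ring
      _ ≤ k * (ε / k) := by
          gcongr
          linarith
      _ = ε := mul_div_cancel₀ _ hk.ne'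
  filter_upwards [eventually_all.2 fun a => eventually_all.2 (hev a)] with m hm x
  refine ⟨(norm_blk_le _).trans (hsum _ fun a b => (hm a b x).1), ?_⟩
  rw [blkExtend, blkExtend, blk_sub_blk]
  exact (norm_blk_le _).trans (hsum _ fun a b => (hm a b x).2)

lemma continuous_mquant {X : Type*} [TopologicalSpace X] (m : ℕ)
    {h : X → Sph → Matrix ι ι ℂ} (hh : ∀ s, Continuous fun x => h x s) :
    Continuous fun x => mquant m (h x) := by
  refine continuous_matrix fun p q => ?_
  simp only [mquant, blk, of_apply, quant_apply]
  have := fun s a b => (hh s).matrix_elem a b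
  fun_prop

lemma mquant_equivariant (m : ℕ) {h h' : Sph → Matrix ι ι ℂ} {wt : ι → ZMod 4} {τ : ZMod 4}
    (hh : ∀ s a b, h' (rot τ s) a b = χ (wt a - wt b) * h s a b) (p q : ι × Fin (sz m + 1)) :
    mquant m h' p q = χ (waveWt wt τ p - waveWt wt τ q) * mquant m h p q := by
  have h1 := quant_rot m τ (fun s => h' s p.1 q.1) p.2 q.2
  simp only [hh, quant_const_mul] at h1
  simp only [mquant, blk, of_apply]
  have h2 : waveWt wt τ p - waveWt wt τ q =
      -(((p.2 : ℕ) : ZMod 4) * τ - (q.2 : ℕ) * τ) + (wt p.1 - wt q.1) := by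
    simp only [waveWt]
    ring
  rw [h2, χ_add, mul_assoc, h1, ← mul_assoc, χ_neg_mul, one_mul]

end MatrixQuantization

section Index

lemma BoundedBelow.mono {ι : Type*} [Fintype ι] [DecidableEq ι] {M : Matrix ι ι ℂ} {c c' : ℝ}
    (h : BoundedBelow M c) (hc : c' ≤ c) : BoundedBelow M c' :=
  fun ξ => (mul_le_mul_of_nonneg_right hc (eNorm_nonneg ξ)).trans (h ξ)

/-- The index of an equivariant family of invertible Hermitian matrices on a product of spheres,
constant where some coordinate is the north pole, is divisible by the Euler class. -/
theorem exists_posg_sub_eq_mul_prod (n : ℕ) : ∀ (τ : Fin n → ZMod 4) {ι : Type} [Fintype ι]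
    [DecidableEq ι] {wt : ι → ZMod 4} {h : (Fin n → Sph) → Matrix ι ι ℂ} {K : Matrix ι ι ℂ}
    {c : ℝ}, 0 < c → Continuous h → (∀ x, (h x).IsHermitian) → (∀ x, BoundedBelow (h x) c) →
    (∀ x a b, h (fun j => rot (τ j) (x j)) a b = χ (wt a - wt b) * h x a b) →
    K.IsHermitian → BoundedBelow K c → Graded K wt → (∀ x j, x j = north → h x = K) →
    ∃ d, posg (h fun _ => south) wt - posg K wt = d * ∏ j, (1 - i4 (-τ j)) := by
  induction n with
  | zero =>
    intros
    exact ⟨_, by rw [Finset.univ_eq_empty, Finset.prod_empty, mul_one]⟩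
  | succ n ih =>
    intro τ ι _ _ wt h K c hc hcont hherm hb heq hK hKb hKg hN
    have hcons : Continuous fun p : (Fin n → Sph) × Sph =>
        h (Fin.cons (α := fun _ => Sph) p.2 p.1) :=
      hcont.comp (Continuous.finCons (A := fun _ => Sph) continuous_snd continuous_fst)
    have hc4 : 0 < c / 4 := by positivity
    obtain ⟨m, hm, hmK⟩ := ((eventually_mquant
      (h := fun (x : Fin n → Sph) s => h (Fin.cons (α := fun _ => Sph) s x)) hcons hc4).and
        (eventually_mquant (h := fun (_ : Unit) _ => K) continuous_const hc4)).exists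
    set h' : (Fin n → Sph) → Matrix _ _ ℂ := fun x =>
      mquant m fun s => h (Fin.cons (α := fun _ => Sph) s x)
    set K' := mquant m fun _ => K
    have hr : 0 < c - c / 4 := by linarith
    have hrc : c - c / 4 ≤ c := by linarith
    have heq' : ∀ x p q, h' (fun j => rot (τ j.succ) (x j)) p q =
        χ (waveWt wt (τ 0) p - waveWt wt (τ 0) q) * h' x p q := by
      intro x
      refine mquant_equivariant m fun s a b => ?_
      rw [← heq]
      congr
      ext1 j
      induction j using Fin.cases <;> rfl
    have hherm' : ∀ x, (h' x).IsHermitian := fun x => isHermitian_mquant m fun s => hherm _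
    have hb' : ∀ x, BoundedBelow (h' x) (c - c / 4) := fun x =>
      boundedBelow_mquant hc.le (fun s => hb _) (hm x).1
    have hK' : K'.IsHermitian := isHermitian_mquant m fun _ => hK
    have hKb' : BoundedBelow K' (c - c / 4) :=
      boundedBelow_mquant hc.le (fun _ => hKb) (hmK ()).1
    have hKeq : ∀ a b, K a b = χ (wt a - wt b) * K a b := by
      intro a b
      by_cases hab : wt a = wt b
      · rw [hab, sub_self, χ_zero, one_mul]
      · rw [hKg a b hab, mul_zero]
    have hKg' : Graded K' (waveWt wt (τ 0)) :=
      graded_of_eq (mquant_equivariant m fun _ => hKeq)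
    obtain ⟨d, hd⟩ := ih (fun j => τ j.succ) (h := h') hr
      (continuous_mquant m fun s => hcons.comp (Continuous.prodMk_left s)) hherm' hb' heq' hK' hKb'
      hKg' fun x j hj => by
        have : ∀ s, h (Fin.cons (α := fun _ => Sph) s x) = K := fun s => hN _ j.succ hj
        simp only [h', this, K']
    have hsouth : Graded (h' fun _ => south) (waveWt wt (τ 0)) := graded_of_eq fun p q => by
      have := heq' (fun _ => south) p q
      simpa only [rot_south] using this
    have hs : (Fin.cons (α := fun _ => Sph) south fun _ : Fin n => south) = fun _ => south := by
      ext1 j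
      induction j using Fin.cases <;> rfl
    have hsg : Graded (h fun _ => south) wt := graded_of_eq fun a b => by
      have := heq (fun _ => south) a b
      simpa only [rot_south] using this
    have e1 := posg_add_eq_of_close (K := K) (L := h fun _ => south) hr (hherm' fun _ => south)
      (hb' _) hsouth hK (hKb.mono hrc) hKg (hherm _) ((hb _).mono hrc) hsg (by
        have h1 := (hm fun _ => south).2
        rw [hs, hN (Fin.cons north _) 0 rfl] at h1
        exact h1.trans_lt (by linarith))
    have e2 := posg_add_eq_of_close (K := K) (L := K) hr hK' hKb' hKg' hK (hKb.mono hrc) hKg hK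
      (hKb.mono hrc) hKg ((hmK ()).2.trans_lt (by linarith))
    refine ⟨d, ?_⟩
    rw [Fin.prod_univ_succ, mul_left_comm, ← hd]
    change posg (h' fun _ => south) _ + _ = _ * posg (h' fun _ => south) _ + _ at e1
    change posg K' _ + _ = _ * posg K' _ + _ at e2
    linear_combination e2 - e1

end Index

section Clifford

lemma BoundedBelow.of_mul_self {ι : Type*} [Fintype ι] [DecidableEq ι] {M : Matrix ι ι ℂ}
    (hM : M.IsHermitian) {c r : ℝ} (hr : 0 < r) (hcr : r ^ 2 ≤ c)
    (h : M * M = (c : ℂ) • 1) : BoundedBelow M r := by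
  intro ξ
  have hc : 0 < c := lt_of_lt_of_le (by positivity) hcr
  have hs : 0 < √c := Real.sqrt_pos.2 hc
  have h1 : ‖M‖ ≤ √c := by
    refine norm_le_of_gram (d := fun _ => (c : ℂ)) ?_ hs.le fun i => ?_
    · rw [hM.eq, h, smul_one_eq_diagonal]
    · rw [Complex.norm_real, Real.norm_of_nonneg hc.le, Real.sq_sqrt hc.le]
  have h2 : ξ = ((c : ℂ)⁻¹ • M) *ᵥ (M *ᵥ ξ) := by
    rw [mulVec_mulVec, Matrix.smul_mul, h, smul_smul,
      inv_mul_cancel₀ (Complex.ofReal_ne_zero.2 hc.ne'), one_smul, one_mulVec]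
  have h3 := eNorm_mulVec_le ((c : ℂ)⁻¹ • M) (M *ᵥ ξ)
  rw [← h2, norm_smul, norm_inv, Complex.norm_real, Real.norm_of_nonneg hc.le] at h3
  have h4 : √c * eNorm ξ ≤ eNorm (M *ᵥ ξ) := by
    calc √c * eNorm ξ ≤ √c * (c⁻¹ * √c * eNorm (M *ᵥ ξ)) := by
          have := eNorm_nonneg (M *ᵥ ξ)
          gcongr
          exact h3.trans (by gcongr)
      _ = (√c * √c) * c⁻¹ * eNorm (M *ᵥ ξ) := by ring
      _ = eNorm (M *ᵥ ξ) := by rw [Real.mul_self_sqrt hc.le, mul_inv_cancel₀ hc.ne', one_mul]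
  exact (mul_le_mul_of_nonneg_right (Real.le_sqrt_of_sq_le hcr) (eNorm_nonneg ξ)).trans h4

lemma qForm_smul_one {ι : Type*} [Fintype ι] [DecidableEq ι] (a : ℝ) (ξ : ι → ℂ) :
    qForm ((a : ℂ) • 1) ξ = a * eNorm ξ ^ 2 := by
  rw [qForm, smul_mulVec, one_mulVec, dotProduct_smul, eNorm_sq, smul_eq_mul, Complex.re_ofReal_mul]
  congr 1
  rw [dotProduct, Complex.re_sum]
  refine Finset.sum_congr rfl fun i _ => ?_
  rw [Pi.star_apply, Complex.star_def, Complex.conj_mul', ← Complex.ofReal_pow, Complex.ofReal_re]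

lemma wtBlock_smul_one {ι : Type*} [Fintype ι] [DecidableEq ι] (a : ℂ) (wt : ι → ZMod 4)
    (c : ZMod 4) : wtBlock (a • (1 : Matrix ι ι ℂ)) wt c = a • 1 := by
  ext k l
  simp [wtBlock, one_apply, Subtype.ext_iff]

lemma posg_one_sub_posg_neg_one :
    posg (((1 : ℝ) : ℂ) • (1 : Matrix Unit Unit ℂ)) (fun _ => 0) -
      posg (((-1 : ℝ) : ℂ) • (1 : Matrix Unit Unit ℂ)) (fun _ => 0) = 1 := by
  have h1 : ∀ c : ZMod 4,
      posIdx (wtBlock (((1 : ℝ) : ℂ) • (1 : Matrix Unit Unit ℂ)) (fun _ => 0) c) =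
        if c = 0 then 1 else 0 := by
    intro c
    rw [wtBlock_smul_one, posIdx_of_pos fun ξ hξ => ?_]
    · by_cases hc : c = 0
      · subst hc
        simp
      · simp [hc, Ne.symm hc]
    · rw [qForm_smul_one]
      have := eNorm_pos hξ
      positivity
  have h2 : ∀ c : ZMod 4,
      posIdx (wtBlock (((-1 : ℝ) : ℂ) • (1 : Matrix Unit Unit ℂ)) (fun _ => 0) c) = 0 := by
    intro c
    rw [wtBlock_smul_one]
    refine posIdx_of_nonpos fun ξ => ?_
    rw [qForm_smul_one]
    have := sq_nonneg (eNorm ξ)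
    linarith
  simp only [posg, h1, h2]
  simp

/-- Clifford matrices with prescribed weights. -/
theorem exists_clifford (q : ℕ) : ∀ s : Fin q → ZMod 4,
    ∃ (ι : Type) (_ : Fintype ι) (_ : DecidableEq ι) (wt : ι → ZMod 4)
      (H : ℝ → (Fin q → ℂ) → Matrix ι ι ℂ),
      Continuous (fun p : ℝ × (Fin q → ℂ) => H p.1 p.2) ∧ (∀ a b, (H a b).IsHermitian) ∧
      (∀ a b, H a b * H a b = ((a ^ 2 + ∑ j, ‖b j‖ ^ 2 : ℝ) : ℂ) • 1) ∧
      (∀ a b k l, H a (fun j => χ (s j) * b j) k l = χ (wt k - wt l) * H a b k l) ∧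
      H (-1) 0 = -H 1 0 ∧ posg (H 1 0) wt - posg (H (-1) 0) wt = ∏ j, (1 - i4 (s j)) := by
  induction q with
  | zero =>
    intro s
    refine ⟨Unit, inferInstance, inferInstance, fun _ => 0, fun a _ => (a : ℂ) • 1, ?_, ?_, ?_, ?_,
      ?_, ?_⟩
    · have : Continuous fun p : ℝ × (Fin 0 → ℂ) => (p.1 : ℂ) := by fun_prop
      exact this.smul continuous_const
    · intro a b
      ext
      simp
    · intro a b
      rw [Matrix.smul_mul, Matrix.mul_smul, Matrix.mul_one, smul_smul]
      simp [sq]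
    · intro a b k l
      simp [χ_zero]
    · simp
    · rw [posg_one_sub_posg_neg_one]
      simp
  | succ q ih =>
    intro s
    obtain ⟨ι, _, _, wt, H, hcont, hherm, hsq, heq, hneg, hpos⟩ := ih fun j => s j.succ
    have hherm' : ∀ a (b : Fin (q + 1) → ℂ), (fromBlocks (H a (Fin.tail b)) (star (b 0) • 1)
        (b 0 • 1) (-H a (Fin.tail b))).IsHermitian := fun a b =>
      .fromBlocks (hherm _ _) (by rw [conjTranspose_smul, conjTranspose_one, star_star])
        (hherm _ _).neg
    have hsq' : ∀ a (b : Fin (q + 1) → ℂ), fromBlocks (H a (Fin.tail b)) (star (b 0) • 1)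
        (b 0 • 1) (-H a (Fin.tail b)) * fromBlocks (H a (Fin.tail b)) (star (b 0) • 1)
        (b 0 • 1) (-H a (Fin.tail b)) = ((a ^ 2 + ∑ j, ‖b j‖ ^ 2 : ℝ) : ℂ) • 1 := by
      intro a b
      have h1 : H a (Fin.tail b) * H a (Fin.tail b) + (star (b 0) * b 0) • 1 =
          ((a ^ 2 + ∑ j, ‖b j‖ ^ 2 : ℝ) : ℂ) • 1 := by
        rw [hsq, ← add_smul, Complex.star_def, Complex.conj_mul', Fin.sum_univ_succ]
        congr 1
        push_cast
        simp only [Fin.tail]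
        ring
      rw [fromBlocks_multiply, ← fromBlocks_one, fromBlocks_smul]
      congr 1
      · simpa [smul_smul, mul_comm] using h1
      · simp
      · simp
      · simpa [smul_smul, mul_comm, add_comm] using h1
    refine ⟨ι ⊕ ι, inferInstance, inferInstance, Sum.elim wt fun k => wt k + s 0,
      fun a b => fromBlocks (H a (Fin.tail b)) (star (b 0) • 1) (b 0 • 1) (-H a (Fin.tail b)),
      ?_, hherm', hsq', ?_, ?_, ?_⟩
    · have h1 : Continuous fun p : ℝ × (Fin (q + 1) → ℂ) => H p.1 (Fin.tail p.2) :=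
        hcont.comp (g := fun p : ℝ × (Fin q → ℂ) => H p.1 p.2)
          (f := fun p : ℝ × (Fin (q + 1) → ℂ) => (p.1, Fin.tail p.2))
          (continuous_fst.prodMk (continuous_pi fun j => by simp only [Fin.tail]; fun_prop))
      have h2 : Continuous fun p : ℝ × (Fin (q + 1) → ℂ) => p.2 0 := by fun_prop
      exact h1.matrix_fromBlocks (h2.star.smul continuous_const) (h2.smul continuous_const) h1.neg
    · intro a b k l
      have ht : Fin.tail (fun j => χ (s j) * b j) = fun j => χ (s j.succ) * Fin.tail b j := rfl
      simp only [ht]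
      rcases k with k | k <;> rcases l with l | l
      · simpa using heq a (Fin.tail b) k l
      · by_cases h : k = l
        · subst h
          simp [← star_χ, mul_comm]
        · simp [h]
      · by_cases h : k = l
        · subst h
          simp
        · simp [h]
      · simpa using heq a (Fin.tail b) k l
    · have ht : Fin.tail (0 : Fin (q + 1) → ℂ) = 0 := rfl
      simp [ht, hneg, fromBlocks_neg]
    · have ht : Fin.tail (0 : Fin (q + 1) → ℂ) = 0 := rfl
      have hg : ∀ a, Graded (H a 0) wt := fun a => graded_of_eq fun k l => by
        have := heq a 0 k l
        simpa [← Pi.zero_def] using this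
      have key : ∀ a : ℝ, a ^ 2 = 1 → posg (fromBlocks (H a (Fin.tail (0 : Fin (q + 1) → ℂ)))
          (star ((0 : Fin (q + 1) → ℂ) 0) • 1) ((0 : Fin (q + 1) → ℂ) 0 • 1)
          (-H a (Fin.tail (0 : Fin (q + 1) → ℂ))))
          (Sum.elim wt fun k => wt k + s 0) =
            posg (H a 0) wt + i4 (s 0) * posg (-H a 0) wt := by
        intro a ha
        rw [posg_sum (Equiv.refl _) (hherm' a 0) ?_ ?_ one_pos
          (.of_mul_self (hherm' a 0) one_pos (c := 1) (by norm_num) ?_), ← posg_shift, ht]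
        · rfl
        · refine .sum (Equiv.refl _) ?_ ?_ ?_ ?_
          · simp
          · simp
          · exact hg a
          · have h1 := (hg a).add_right (s 0)
            intro k l hkl
            simpa [ht] using h1 k l hkl
        · simp
        · rw [hsq' a 0]
          simp [ha]
      rw [key 1 (by norm_num), key (-1) (by norm_num), hneg, neg_neg, Fin.prod_univ_succ, ← hpos,
        hneg]
      ring

end Clifford

section Collapse

/-- The stereographic coordinate. -/
noncomputable def stereo (y : Sph) : ℂ := y.1.2 / ((1 - y.1.1) ^ 2 : ℝ)

lemma height_lt_one {y : Sph} (hy : y ≠ north) : y.1.1 < 1 := by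
  refine lt_of_le_of_ne y.2.1.2 fun h => hy (Subtype.ext (Prod.ext h ?_))
  have := y.2.2
  rw [h, sub_self, mul_zero, norm_eq_zero] at this
  exact this

lemma norm_stereo {y : Sph} (hy : y ≠ north) : ‖stereo y‖ = y.1.1 / (1 - y.1.1) := by
  have h := sub_pos.2 (height_lt_one hy)
  rw [stereo, norm_div, Complex.norm_real, y.2.2, norm_pow, Real.norm_of_nonneg h.le]
  field_simp

lemma continuousAt_stereo {y : Sph} (hy : y ≠ north) : ContinuousAt stereo y := by
  have h := sub_pos.2 (height_lt_one hy)
  have hne : (((1 - y.1.1) ^ 2 : ℝ) : ℂ) ≠ 0 := Complex.ofReal_ne_zero.2 (by positivity)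
  have h1 : Continuous fun y : Sph => y.1.2 := by fun_prop
  have h2 : Continuous fun y : Sph => (((1 - y.1.1) ^ 2 : ℝ) : ℂ) := by fun_prop
  exact h1.continuousAt.div h2.continuousAt hne

lemma stereo_rot (c : ZMod 4) (y : Sph) : stereo (rot c y) = χ c * stereo y := by
  simp only [stereo, rot, mul_div_assoc]

lemma stereo_south : stereo south = 0 := by
  simp [stereo, south]

lemma rot_eq_north_iff {c : ZMod 4} {y : Sph} : rot c y = north ↔ y = north := by
  refine ⟨fun h => ?_, fun h => by rw [h, rot_north]⟩
  by_contra hy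
  have h1 := height_lt_one hy
  have h2 : y.1.1 = 1 := congrArg (fun z : Sph => z.1.1) h
  linarith

variable {κ : Type*} [Fintype κ] {E : Type*}

open Classical in
/-- Extension to a product of spheres of a function on affine space with a value at infinity. -/
noncomputable def collapse (Ψ : (κ → ℂ) → E) (k : E) (x : κ → Sph) : E :=
  if ∃ j, x j = north then k else Ψ fun j => stereo (x j)

lemma continuous_collapse [TopologicalSpace E] {Ψ : (κ → ℂ) → E} {k : E} (hΨ : Continuous Ψ)
    (hk : Tendsto Ψ (cocompact _) (𝓝 k)) : Continuous (collapse Ψ k) := by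
  rw [continuous_iff_continuousAt]
  intro x
  by_cases hx : ∃ j, x j = north
  · obtain ⟨j, hj⟩ := hx
    have hval : collapse Ψ k x = k := if_pos ⟨j, hj⟩
    rw [ContinuousAt, hval]
    intro U hU
    have h1 := hk hU
    rw [← Metric.cobounded_eq_cocompact, mem_map,
      (hasBasis_cobounded_norm (E := κ → ℂ)).mem_iff] at h1
    obtain ⟨R, -, hR⟩ := h1
    have hopen : IsOpen {y : κ → Sph | R * (1 - (y j).1.1) < (y j).1.1} :=
      isOpen_lt (by fun_prop) (by fun_prop)
    have hmem : x ∈ {y : κ → Sph | R * (1 - (y j).1.1) < (y j).1.1} := by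
      simp [hj, north]
    rw [mem_map]
    filter_upwards [hopen.mem_nhds hmem] with y hy
    by_cases hy' : ∃ j, y j = north
    · rw [Set.mem_preimage, collapse, if_pos hy']
      exact mem_of_mem_nhds hU
    · rw [Set.mem_preimage, collapse, if_neg hy']
      push Not at hy'
      refine hR ?_
      have h2 : R ≤ ‖stereo (y j)‖ := by
        rw [norm_stereo (hy' j), le_div_iff₀ (sub_pos.2 (height_lt_one (hy' j)))]
        exact le_of_lt hy
      exact h2.trans (norm_le_pi_norm (fun j => stereo (y j)) j)
  · have hclosed : IsClosed {y : κ → Sph | ∃ j, y j = north} := by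
      have : {y : κ → Sph | ∃ j, y j = north} = ⋃ j, {y | y j = north} := by
        ext
        simp
      rw [this]
      exact isClosed_iUnion_of_finite fun j => isClosed_eq (continuous_apply j) continuous_const
    have hev : collapse Ψ k =ᶠ[𝓝 x] fun y => Ψ fun j => stereo (y j) := by
      filter_upwards [hclosed.isOpen_compl.mem_nhds hx] with y hy
      exact if_neg hy
    rw [continuousAt_congr hev]
    refine hΨ.continuousAt.comp (continuousAt_pi.2 fun j => ?_)
    push Not at hx
    exact ContinuousAt.comp (f := fun y : κ → Sph => y j) (continuousAt_stereo (hx j))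
      (continuous_apply j).continuousAt

lemma collapse_of_north (Ψ : (κ → ℂ) → E) (k : E) {x : κ → Sph} {j : κ} (h : x j = north) :
    collapse Ψ k x = k :=
  if_pos ⟨j, h⟩

lemma collapse_south (Ψ : (κ → ℂ) → E) (k : E) : collapse Ψ k (fun _ => south) = Ψ 0 := by
  have h : south ≠ north := by simp [south, north]
  rw [collapse, if_neg (by simp [h])]
  simp only [stereo_south]
  rfl

lemma collapse_rot {Ψ : (κ → ℂ) → E} {k : E} {τ : κ → ZMod 4} {T : E → E}
    (hΨ : ∀ z, Ψ (fun j => χ (τ j) * z j) = T (Ψ z)) (hk : T k = k) (x : κ → Sph) :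
    collapse Ψ k (fun j => rot (τ j) (x j)) = T (collapse Ψ k x) := by
  simp only [collapse, rot_eq_north_iff, stereo_rot, hΨ]
  split_ifs
  · exact hk.symm
  · rfl

lemma collapse_mem {Ψ : (κ → ℂ) → E} {k : E} {p : E → Prop} (hΨ : ∀ z, p (Ψ z)) (hk : p k)
    (x : κ → Sph) : p (collapse Ψ k x) := by
  rw [collapse]
  split_ifs
  · exact hk
  · exact hΨ _

end Collapse

section Divisibility

variable {κ κ' : Type*} [Fintype κ] [Fintype κ']

/-- An equivariant map between affine spaces, suitably behaved at infinity, forces a divisibility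
between Euler classes. -/
theorem exists_prod_eq_mul_prod {τ : κ → ZMod 4} {s : κ' → ZMod 4}
    {Ψ : (κ → ℂ) → ℝ × (κ' → ℂ)} (hΨ : Continuous Ψ)
    (hlim : Tendsto Ψ (cocompact _) (𝓝 (-1, 0))) (hne : ∀ z, Ψ z ≠ 0) (h0 : Ψ 0 = (1, 0))
    (heq : ∀ z, Ψ (fun j => χ (τ j) * z j) = ((Ψ z).1, fun j => χ (s j) * (Ψ z).2 j)) :
    ∃ d, ∏ j, (1 - i4 (s j)) = d * ∏ j, (1 - i4 (-τ j)) := by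
  let e := Fintype.equivFin κ
  let e' := Fintype.equivFin κ'
  obtain ⟨ι, _, _, wt, H, hcont, hherm, hsq, hH, -, hpos⟩ := exists_clifford _ (s ∘ e'.symm)
  let Φ : (κ → Sph) → ℝ × (κ' → ℂ) := collapse Ψ (-1, 0)
  have hΦ : Continuous Φ := continuous_collapse hΨ hlim
  have hΦne : ∀ x, Φ x ≠ 0 := fun x =>
    collapse_mem (Ψ := Ψ) (p := (· ≠ 0)) hne (by simp) x
  let N : (κ → Sph) → ℝ := fun x => (Φ x).1 ^ 2 + ∑ j, ‖(Φ x).2 j‖ ^ 2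
  have hN : Continuous N := by fun_prop
  have hNpos : ∀ x, 0 < N x := by
    intro x
    by_contra! h
    have h1 : 0 ≤ ∑ j, ‖(Φ x).2 j‖ ^ 2 := Finset.sum_nonneg fun j _ => sq_nonneg _
    have h2 : (Φ x).1 ^ 2 = 0 := le_antisymm (by linarith) (sq_nonneg _)
    have h3 : ∑ j, ‖(Φ x).2 j‖ ^ 2 = 0 := le_antisymm (by linarith [sq_nonneg (Φ x).1]) h1
    rw [Finset.sum_eq_zero_iff_of_nonneg fun j _ => sq_nonneg _] at h3
    refine hΦne x (Prod.ext (pow_eq_zero_iff two_ne_zero |>.1 h2) (funext fun j => ?_))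
    simpa using h3 j
  have : Nonempty (κ → Sph) := ⟨fun _ => south⟩
  obtain ⟨x₀, -, hx₀⟩ := isCompact_univ.exists_isMinOn Set.univ_nonempty hN.continuousOn
  have hmin : ∀ x, N x₀ ≤ N x := fun x => hx₀ (Set.mem_univ x)
  have hc : 0 < √(min (N x₀) 1) := Real.sqrt_pos.2 (lt_min (hNpos _) one_pos)
  have hcsq : √(min (N x₀) 1) ^ 2 = min (N x₀) 1 :=
    Real.sq_sqrt (lt_min (hNpos _) one_pos).le
  have hsum : ∀ b : κ' → ℂ, ∑ j, ‖(b ∘ e'.symm) j‖ ^ 2 = ∑ j, ‖b j‖ ^ 2 := fun b =>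
    e'.symm.sum_comp fun j => ‖b j‖ ^ 2
  have hg : Graded (H (-1) 0) wt := graded_of_eq fun k l => by
    have := hH (-1) 0 k l
    simpa [← Pi.zero_def] using this
  obtain ⟨d, hd⟩ := exists_posg_sub_eq_mul_prod _ (τ ∘ e.symm) (wt := wt)
    (h := fun x => H (Φ (x ∘ e)).1 ((Φ (x ∘ e)).2 ∘ e'.symm)) (K := H (-1) 0) hc
    (hcont.comp (g := fun p : ℝ × (Fin (Fintype.card κ') → ℂ) => H p.1 p.2)
      (f := fun x : Fin (Fintype.card κ) → Sph => ((Φ (x ∘ e)).1, (Φ (x ∘ e)).2 ∘ e'.symm))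
      (by fun_prop))
    (fun x => hherm _ _)
    (fun x => .of_mul_self (c := N (x ∘ e)) (hherm _ _) hc
      (hcsq.trans_le ((min_le_left _ _).trans (hmin _))) (by rw [hsq, hsum]))
    (fun x a b => by
      have h1 : Φ (fun j => rot (τ j) ((x ∘ e) j)) = _ := collapse_rot (Ψ := Ψ)
        (T := fun v => (v.1, fun j => χ (s j) * v.2 j)) heq (k := (-1, 0)) (by ext <;> simp) (x ∘ e)
      have h2 : (fun j => rot ((τ ∘ e.symm) j) (x j)) ∘ e =
          fun j => rot (τ j) ((x ∘ e) j) := by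
        ext1 j
        simp
      rw [h2, h1, ← hH]
      rfl)
    (hherm _ _)
    (.of_mul_self (c := 1) (hherm _ _) hc (hcsq.trans_le (min_le_right _ _)) (by rw [hsq]; simp))
    hg
    (fun x j hj => by
      have : Φ (x ∘ e) = (-1, 0) := collapse_of_north _ _ (j := e.symm j) (by simpa using hj)
      rw [this]
      rfl)
  refine ⟨d, ?_⟩
  have hΦ0 : Φ ((fun _ => south) ∘ e) = (1, 0) := (collapse_south Ψ _).trans h0
  have e1 : ∏ j, (1 - i4 ((s ∘ e'.symm) j)) = ∏ j, (1 - i4 (s j)) :=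
    e'.symm.prod_comp fun j => 1 - i4 (s j)
  have e2 : ∏ j, (1 - i4 (-(τ ∘ e.symm) j)) = ∏ j, (1 - i4 (-τ j)) :=
    e.symm.prod_comp fun j => 1 - i4 (-τ j)
  rw [hΦ0] at hd
  rw [← e1, ← e2, ← hd, ← hpos]
  rfl

end Divisibility

section Complexification

lemma tendsto_cocompact_of_onePoint_prod {X Y E : Type*} [TopologicalSpace X] [T2Space X]
    [TopologicalSpace Y] [T2Space Y] [TopologicalSpace E]
    {F : OnePoint X × OnePoint Y → E} (hF : Continuous F) {k : E}
    (h1 : ∀ y, F (∞, y) = k) (h2 : ∀ x, F (x, ∞) = k) :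
    Tendsto (fun p : X × Y => F (p.1, p.2)) (cocompact _) (𝓝 k) := by
  rw [← coprod_cocompact, Filter.coprod, tendsto_sup]
  constructor
  · have hs := hF.tendsto_nhdsSet_nhds (s := {(∞ : OnePoint X)} ×ˢ Set.univ) (b := k) (by
      rintro ⟨x, y⟩ ⟨rfl, -⟩
      exact h1 y)
    rw [isCompact_singleton.nhdsSet_prod_eq isCompact_univ, nhdsSet_singleton, nhdsSet_univ] at hs
    rw [← coclosedCompact_eq_cocompact]
    exact hs.comp ((tendsto_coe_infty.comp tendsto_comap).prodMk tendsto_top)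
  · have hs := hF.tendsto_nhdsSet_nhds (s := Set.univ ×ˢ {(∞ : OnePoint Y)}) (b := k) (by
      rintro ⟨x, y⟩ ⟨-, rfl⟩
      exact h2 x)
    rw [isCompact_univ.nhdsSet_prod_eq isCompact_singleton, nhdsSet_singleton, nhdsSet_univ] at hs
    rw [← coclosedCompact_eq_cocompact]
    exact hs.comp (tendsto_top.prodMk (tendsto_coe_infty.comp tendsto_comap))

/-- The embedding of the one-point compactification of `W` into `ℝ × W` by the normalised vectors
`(1, w) / (1 + ‖w‖ ^ 2)`, with infinity sent to the origin. -/
noncomputable def damp {W : Type*} [NormedAddCommGroup W] [NormedSpace ℝ W] :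
    OnePoint W → ℝ × W
  | ∞ => 0
  | (w : W) => ((1 + ‖w‖ ^ 2)⁻¹, (1 + ‖w‖ ^ 2)⁻¹ • w)

section Damp

variable {W : Type*} [NormedAddCommGroup W] [NormedSpace ℝ W]

lemma damp_infty : damp (∞ : OnePoint W) = 0 := rfl

lemma damp_coe (w : W) : damp (w : OnePoint W) = ((1 + ‖w‖ ^ 2)⁻¹, (1 + ‖w‖ ^ 2)⁻¹ • w) := rfl

lemma damp_zero : damp ((0 : W) : OnePoint W) = (1, 0) := by
  simp [damp_coe]

lemma continuous_damp [ProperSpace W] : Continuous (damp : OnePoint W → ℝ × W) := by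
  have hpos : ∀ w : W, 1 + ‖w‖ ^ 2 ≠ 0 := fun w => by positivity
  have hnorm : Tendsto (fun w : W => ‖w‖) (cocompact W) atTop := tendsto_norm_cocompact_atTop
  have hlim : Tendsto (fun w : W => ‖w‖⁻¹) (cocompact W) (𝓝 0) := tendsto_inv_atTop_zero.comp hnorm
  have hbound : ∀ w : W, (1 + ‖w‖ ^ 2)⁻¹ * ‖w‖ ≤ ‖w‖⁻¹ := by
    intro w
    rcases (norm_nonneg w).eq_or_lt with h | h
    · simp [← h]
    · rw [inv_mul_le_iff₀ (by positivity)]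
      field_simp
      linarith
  have h1 : Tendsto (fun w : W => (1 + ‖w‖ ^ 2)⁻¹) (cocompact W) (𝓝 0) :=
    tendsto_inv_atTop_zero.comp
      (tendsto_atTop_add_const_left _ _ ((tendsto_pow_atTop two_ne_zero).comp hnorm))
  have h2 : Tendsto (fun w : W => (1 + ‖w‖ ^ 2)⁻¹ • w) (cocompact W) (𝓝 0) := by
    refine squeeze_zero_norm (fun w => ?_) hlim
    rw [norm_smul, norm_inv, Real.norm_of_nonneg (by positivity)]
    exact hbound w
  rw [OnePoint.continuous_iff, coclosedCompact_eq_cocompact]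
  refine ⟨?_, ?_⟩
  · exact h1.prodMk_nhds h2
  · simp only [damp_coe]
    have hinv : Continuous fun w : W => (1 + ‖w‖ ^ 2)⁻¹ := .inv₀ (by fun_prop) hpos
    exact hinv.prodMk (hinv.smul continuous_id)

lemma damp_map {ρ : W → W} (hρ : ∀ w, ‖ρ w‖ = ‖w‖) (hsmul : ∀ (r : ℝ) w, ρ (r • w) = r • ρ w)
    (w : OnePoint W) : damp (OnePoint.map ρ w) = ((damp w).1, ρ (damp w).2) := by
  induction w using OnePoint.rec with
  | infty =>
    have h0 : ρ 0 = 0 := by simpa using hsmul 0 0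
    simp [damp_infty, h0, Prod.zero_eq_mk]
  | coe w => simp [damp_coe, hρ, hsmul]

lemma damp_fst_eq_zero_iff {w : OnePoint W} : (damp w).1 = 0 ↔ w = ∞ := by
  induction w using OnePoint.rec with
  | infty => simp [damp_infty]
  | coe w =>
    have : 1 + ‖w‖ ^ 2 ≠ 0 := by positivity
    simp [damp_coe, this]

lemma eq_zero_of_damp_snd_eq_zero {w : OnePoint W} (hw : w ≠ ∞) (h : (damp w).2 = 0) :
    w = ((0 : W) : OnePoint W) := by
  induction w using OnePoint.rec with
  | infty => exact absurd rfl hw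
  | coe w =>
    have h1 : 1 + ‖w‖ ^ 2 ≠ 0 := by positivity
    simpa [damp_coe, h1] using h

end Damp

/-- The representation space. -/
abbrev Rep (N M : ℕ) : Type := EuclideanSpace ℂ (Fin N) × EuclideanSpace ℝ (Fin M)

/-- The action of a generator of the cyclic group on `Rep N M`. -/
noncomputable def rho {N M : ℕ} (p : Rep N M) : Rep N M := (Complex.I • p.1, -p.2)

lemma norm_rho {N M : ℕ} (p : Rep N M) : ‖rho p‖ = ‖p‖ := by
  simp [rho, Prod.norm_def, norm_smul]

lemma rho_smul {N M : ℕ} (r : ℝ) (p : Rep N M) : rho (r • p) = r • rho p := by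
  ext <;> simp [rho, smul_comm Complex.I r, mul_left_comm]

/-- Coordinates on two copies of `Rep N M`. -/
abbrev Coord (N M : ℕ) : Type := (Fin N ⊕ Fin N) ⊕ Fin M

/-- The weights of the cyclic group action on the coordinates. -/
def coordWt (N M : ℕ) : Coord N M → ZMod 4 := Sum.elim (fun _ => 1) fun _ => 2

/-- Two vectors from complex coordinates. -/
noncomputable def split {N M : ℕ} (z : Coord N M → ℂ) : Rep N M × Rep N M :=
  ((WithLp.toLp 2 fun j => z (.inl (.inl j)), WithLp.toLp 2 fun j => (z (.inr j)).re),
    (WithLp.toLp 2 fun j => z (.inl (.inr j)), WithLp.toLp 2 fun j => (z (.inr j)).im))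

/-- Complex coordinates of a pair of vectors. -/
noncomputable def join {N M : ℕ} (p : Rep N M × Rep N M) : Coord N M → ℂ :=
  Sum.elim (Sum.elim (fun j => p.1.1 j) fun j => p.2.1 j) fun j => ⟨p.1.2 j, p.2.2 j⟩

section Coord

variable {N M : ℕ}

lemma join_split (z : Coord N M → ℂ) : join (split z) = z := by
  ext ((j | j) | j) <;> rfl

lemma split_join (p : Rep N M × Rep N M) : split (join p) = p := rfl

lemma continuous_split : Continuous (split : (Coord N M → ℂ) → _) := by
  unfold split
  fun_prop

lemma continuous_join : Continuous (join : Rep N M × Rep N M → Coord N M → ℂ) := by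
  refine continuous_pi ?_
  rintro ((j | j) | j)
  · simp only [join, Sum.elim_inl]
    fun_prop
  · simp only [join, Sum.elim_inl, Sum.elim_inr]
    fun_prop
  · simp only [join, Sum.elim_inr, Complex.mk_eq_add_mul_I]
    fun_prop

lemma tendsto_split : Tendsto (split : (Coord N M → ℂ) → _) (cocompact _) (cocompact _) :=
  ((show Function.LeftInverse join split from join_split).isClosedEmbedding
    continuous_join continuous_split).tendsto_cocompact

lemma join_rho (p : Rep N M × Rep N M) (j : Coord N M) :
    join (rho p.1, rho p.2) j = χ (coordWt N M j) * join p j := by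
  rcases j with (j | j) | j
  · simp [join, rho, coordWt, χ_one]
  · simp [join, rho, coordWt, χ_one]
  · simp [join, rho, coordWt, χ_two, Complex.ext_iff]

lemma split_coordWt (z : Coord N M → ℂ) :
    split (fun j => χ (coordWt N M j) * z j) = (rho (split z).1, rho (split z).2) := by
  have h : (fun j => χ (coordWt N M j) * z j) = join (rho (split z).1, rho (split z).2) := by
    ext j
    rw [join_rho, join_split]
  rw [h, split_join]

/-- The pairing of two points of the one-point compactification into a punctured linear space,
constant when one of the points is infinite. -/
noncomputable def pairing (w : OnePoint (Rep N M) × OnePoint (Rep N M)) :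
    ℝ × (Coord N M → ℂ) :=
  (2 * (damp w.1).1 * (damp w.2).1 - 1,
    join ((damp w.2).1 • (damp w.1).2, (damp w.1).1 • (damp w.2).2))

lemma continuous_pairing : Continuous (pairing (N := N) (M := M)) := by
  have h := continuous_damp (W := Rep N M)
  have h1 : Continuous fun w : OnePoint (Rep N M) × OnePoint (Rep N M) => damp w.1 :=
    h.comp continuous_fst
  have h2 : Continuous fun w : OnePoint (Rep N M) × OnePoint (Rep N M) => damp w.2 :=
    h.comp continuous_snd
  refine .prodMk (by fun_prop) (continuous_join.comp (by fun_prop))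

lemma join_zero : join (0 : Rep N M × Rep N M) = 0 := by
  rw [← join_split (0 : Coord N M → ℂ)]
  rfl

lemma pairing_infty_left (w : OnePoint (Rep N M)) : pairing (∞, w) = (-1, 0) := by
  simp [pairing, damp_infty, ← Prod.zero_eq_mk, join_zero]

lemma pairing_infty_right (w : OnePoint (Rep N M)) : pairing (w, ∞) = (-1, 0) := by
  simp [pairing, damp_infty, ← Prod.zero_eq_mk, join_zero]

lemma pairing_zero :
    pairing (((0 : Rep N M) : OnePoint (Rep N M)), ((0 : Rep N M) : OnePoint (Rep N M))) =
      (1, 0) := by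
  simp only [pairing, damp_zero, smul_zero, ← Prod.zero_eq_mk, join_zero]
  norm_num

lemma pairing_ne_zero (w : OnePoint (Rep N M) × OnePoint (Rep N M)) : pairing w ≠ 0 := by
  obtain ⟨w1, w2⟩ := w
  intro h
  have h1 : w1 ≠ ∞ := by
    rintro rfl
    rw [pairing_infty_left] at h
    simpa using congrArg Prod.fst h
  have h2 : w2 ≠ ∞ := by
    rintro rfl
    rw [pairing_infty_right] at h
    simpa using congrArg Prod.fst h
  have h3 : ((damp w2).1 • (damp w1).2, (damp w1).1 • (damp w2).2) =
      split (0 : Coord N M → ℂ) := congrArg (fun v => split v.2) h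
  rw [← join_zero, split_join] at h3
  have h4 : (damp w2).1 • (damp w1).2 = 0 := congrArg Prod.fst h3
  have h5 : (damp w1).1 • (damp w2).2 = 0 := congrArg Prod.snd h3
  rw [smul_eq_zero, damp_fst_eq_zero_iff, or_iff_right h2] at h4
  rw [smul_eq_zero, damp_fst_eq_zero_iff, or_iff_right h1] at h5
  rw [eq_zero_of_damp_snd_eq_zero h1 h4, eq_zero_of_damp_snd_eq_zero h2 h5, pairing_zero] at h
  simpa using congrArg Prod.fst h

lemma damp_sigmaMap (w : OnePoint (Rep N M)) :
    damp (sigmaMap N M w) = ((damp w).1, rho (damp w).2) :=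
  damp_map norm_rho rho_smul w

lemma pairing_sigmaMap (w1 w2 : OnePoint (Rep N M)) :
    pairing (sigmaMap N M w1, sigmaMap N M w2) =
      ((pairing (w1, w2)).1, fun j => χ (coordWt N M j) * (pairing (w1, w2)).2 j) := by
  simp only [pairing, damp_sigmaMap, ← rho_smul, ← join_rho]

lemma norm_prod_coordWt {g : ZMod 4 → GaussianInt} (h1 : (g 1).norm = 2) (h2 : (g 2).norm = 4) :
    (∏ j, g (coordWt N M j)).norm = 4 ^ (N + M) := by
  have h : (∏ j, g (coordWt N M j)).norm = ∏ j, (g (coordWt N M j)).norm :=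
    map_prod Zsqrtd.normMonoidHom _ _
  rw [h]
  simp only [Fintype.prod_sum_type, coordWt, Sum.elim_inl, Sum.elim_inr, h1, h2,
    Finset.prod_const, Finset.card_univ, Fintype.card_fin, Fintype.card_sum]
  rw [← two_mul, pow_mul, pow_add]
  norm_num

end Coord

end Complexification

end WeakBorsukUlam

open WeakBorsukUlam in
/-- **Weak Borsuk–Ulam type theorem.**  If there is a continuous pointed map
`f : (ℂ₊^{n₀} ⊕ ℝ̃^{m₀})⁺ → (ℂ₊^{n₁} ⊕ ℝ̃^{m₁})⁺` with `f ∞ = ∞`, `f 0 = 0`, which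
intertwines the `ℤ/4`-actions generated by `σ`, then `n₀ - n₁ ≤ m₁ - m₀`. -/
theorem weak_borsuk_ulam (n₀ n₁ m₀ m₁ : ℕ)
    (f : OnePoint (EuclideanSpace ℂ (Fin n₀) × EuclideanSpace ℝ (Fin m₀)) →
      OnePoint (EuclideanSpace ℂ (Fin n₁) × EuclideanSpace ℝ (Fin m₁)))
    (hf : Continuous f)
    (hinf : f OnePoint.infty = OnePoint.infty)
    (h0 : f (OnePoint.some 0) = OnePoint.some 0)
    (heq : f ∘ sigmaMap n₀ m₀ = sigmaMap n₁ m₁ ∘ f) :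
    (n₀ : ℤ) - (n₁ : ℤ) ≤ (m₁ : ℤ) - (m₀ : ℤ) := by
  let F := fun w : OnePoint (Rep n₀ m₀) × OnePoint (Rep n₀ m₀) => pairing (f w.1, f w.2)
  have hF : Continuous F := continuous_pairing.comp (by fun_prop)
  have hlim := (tendsto_cocompact_of_onePoint_prod hF (k := (-1, 0))
    (fun y => by simp only [F, hinf, pairing_infty_left])
    (fun x => by simp only [F, hinf, pairing_infty_right])).comp tendsto_split
  have hsig : ∀ w : Rep n₀ m₀,
      f ((rho w : Rep n₀ m₀) : OnePoint (Rep n₀ m₀)) = sigmaMap n₁ m₁ (f w) := fun w =>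
    congrFun heq (w : OnePoint (Rep n₀ m₀))
  obtain ⟨d, hd⟩ := exists_prod_eq_mul_prod (τ := coordWt n₀ m₀) (s := coordWt n₁ m₁)
    (Ψ := fun z => F ((split z).1, (split z).2))
    (hF.comp (((continuous_coe.comp continuous_fst).prodMk
      (continuous_coe.comp continuous_snd)).comp continuous_split)) hlim
    (fun z => pairing_ne_zero _)
    (by
      have : split (0 : Coord n₀ m₀ → ℂ) = 0 := by rw [← join_zero, split_join]
      simp only [F, this, Prod.fst_zero, Prod.snd_zero, h0, pairing_zero])
    (fun z => by simp only [F, split_coordWt, hsig, pairing_sigmaMap])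
  have h1 := congrArg Zsqrtd.norm hd
  rw [Zsqrtd.norm_mul, norm_prod_coordWt (g := fun c => 1 - i4 c) (by decide) (by decide),
    norm_prod_coordWt (g := fun c => 1 - i4 (-c)) (by decide) (by decide)] at h1
  have h2 : (4 : ℤ) ^ (n₀ + m₀) ≤ 4 ^ (n₁ + m₁) :=
    Int.le_of_dvd (by positivity) ⟨_, h1.trans (mul_comm _ _)⟩
  have h3 := (pow_le_pow_iff_right₀ (by norm_num : (1 : ℤ) < 4)).1 h2
  omega
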